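/- Let η = 0.16656. There is an absolute constant c > 0 such that for every sufficiently large prime p and every positive integer h with h ≥ c · p^{11/24} · (log p)^{4/3 + η/6} · (log log p)^{1/2}, the following holds: for every s ∈ F_p the interval {s+1, s+2, …, s+h} contains an element x with both x ∈ R and x+1 ∈ R, and also contains an element y with both y ∈ N and y+1 ∈ N. -/

import Mathlib

open Finset

/-- The set of nonzero quadratic residues in `F_p`. -/
def quadRes (p : ℕ) [Fact p.Prime] : Finset (ZMod p) :=
  Finset.univ.filter fun x => ∃ y : ZMod p, y ≠ 0 ∧ y ^ 2 = x

/-- The set of quadratic non-residues in `F_p`. -/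
def nonRes (p : ℕ) [Fact p.Prime] : Finset (ZMod p) :=
  Finset.univ.filter fun x => x ≠ 0 ∧ x ∉ quadRes p

section Stepanov

open Polynomial

variable {p : ℕ} [Fact p.Prime]

/-- The polynomial `T k r` with `(f ^ N * r)⁽ᵏ⁾ = f ^ (N - k) * T k r`, as a linear map in `r`. -/
noncomputable def powMulDeriv (f : (ZMod p)[X]) (N : ℕ) :
    ℕ → (ZMod p)[X] →ₗ[ZMod p] (ZMod p)[X]
  | 0 => LinearMap.id
  | k + 1 =>
    (LinearMap.mulLeft (ZMod p) f ∘ₗ derivative +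
      LinearMap.mulLeft (ZMod p) (((N - k : ℕ) : (ZMod p)[X]) * derivative f)) ∘ₗ
        powMulDeriv f N k

lemma iterate_derivative_pow_mul (f r : (ZMod p)[X]) {N k : ℕ} (hk : k ≤ N) :
    derivative^[k] (f ^ N * r) = f ^ (N - k) * powMulDeriv f N k r := by
  induction k with
  | zero => simp [powMulDeriv]
  | succ k ih =>
    rw [Function.iterate_succ_apply', ih (by lia)]
    obtain ⟨m, hm⟩ : ∃ m, N - k = m + 1 := ⟨N - k - 1, by lia⟩
    have hm' : N - (k + 1) = m := by lia
    simp only [powMulDeriv, hm, hm', LinearMap.comp_apply, LinearMap.add_apply,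
      LinearMap.mulLeft_apply, derivative_mul, derivative_pow_succ, Nat.cast_add, Nat.cast_one,
      map_add, map_natCast, map_one]
    ring

lemma natDegree_powMulDeriv_le (f r : (ZMod p)[X]) (N k : ℕ) :
    (powMulDeriv f N k r).natDegree ≤ r.natDegree + k * f.natDegree := by
  induction k with
  | zero => simp [powMulDeriv]
  | succ k ih =>
    simp only [powMulDeriv, LinearMap.comp_apply, LinearMap.add_apply, LinearMap.mulLeft_apply]
    have h1 := natDegree_derivative_le (powMulDeriv f N k r)
    have h2 := natDegree_derivative_le f
    have h3 : (((N - k : ℕ) : (ZMod p)[X]) * derivative f).natDegree ≤ f.natDegree := by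
      refine natDegree_mul_le.trans ?_
      simp only [natDegree_natCast]
      lia
    have h4 := natDegree_mul_le (p := f) (q := derivative (powMulDeriv f N k r))
    have h5 := natDegree_mul_le (p := ((N - k : ℕ) : (ZMod p)[X]) * derivative f)
      (q := powMulDeriv f N k r)
    refine (natDegree_add_le _ _).trans (max_le ?_ ?_) <;> rw [Nat.succ_mul] <;> lia

lemma iterate_derivative_X_pow_mul (h : (ZMod p)[X]) (j k : ℕ) :
    derivative^[k] (X ^ (p * j) * h) = X ^ (p * j) * derivative^[k] h := by
  induction k with
  | zero => simp
  | succ k ih =>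
    rw [Function.iterate_succ_apply', ih, derivative_mul, derivative_X_pow]
    simp [Function.iterate_succ_apply']

/-- `F = ∑ X ^ (p j) (r_j + s_j f ^ n)` is nonzero unless all `r_j`, `s_j` vanish. -/
lemma sum_X_pow_mul_ne_zero (f : (ZMod p)[X]) (hp : p ≠ 2) {α : ZMod p}
    (hα : Odd (f.rootMultiplicity α)) (h0 : f.coeff 0 ≠ 0) {A J : ℕ}
    (hA : 2 * A + f.natDegree ≤ p) (r s : ℕ → (ZMod p)[X])
    (hr : ∀ j, (r j).degree < A) (hs : ∀ j, (s j).degree < A)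
    (hne : ∃ j < J, r j ≠ 0 ∨ s j ≠ 0) :
    ∑ j ∈ range J, X ^ (p * j) * (r j + s j * f ^ (p / 2)) ≠ 0 := by
  intro hsum
  classical
  have hf0 : f ≠ 0 := by rintro rfl; simp at h0
  set j₀ := Nat.find hne with hj₀
  obtain ⟨hj₀J, hj₀ne⟩ := Nat.find_spec hne
  rw [← hj₀] at hj₀J hj₀ne
  have hmin : ∀ j < j₀, r j = 0 ∧ s j = 0 := by
    intro j hj
    have := Nat.find_min hne hj
    by_contra hcon
    exact this ⟨hj.trans hj₀J, by tauto⟩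
  have hsplit : X ^ (p * j₀) * (r j₀ + s j₀ * f ^ (p / 2)) +
      ∑ j ∈ (range J).erase j₀, X ^ (p * j) * (r j + s j * f ^ (p / 2)) = 0 := by
    rw [Finset.add_sum_erase (range J)
      (fun j => X ^ (p * j) * (r j + s j * f ^ (p / 2))) (mem_range.2 hj₀J), hsum]
  have hdvd : X ^ (p * j₀) * X ^ p ∣
      ∑ j ∈ (range J).erase j₀, X ^ (p * j) * (r j + s j * f ^ (p / 2)) := by
    refine Finset.dvd_sum fun j hj => ?_
    rw [mem_erase] at hj
    rcases lt_or_gt_of_ne hj.1 with h | h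
    · simp [hmin j h]
    · refine Dvd.dvd.mul_right ?_ _
      rw [← pow_add]
      exact pow_dvd_pow _ (by nlinarith)
  have hdvd2 : X ^ p ∣ r j₀ + s j₀ * f ^ (p / 2) := by
    have h1 : X ^ (p * j₀) * X ^ p ∣ X ^ (p * j₀) * (r j₀ + s j₀ * f ^ (p / 2)) := by
      rw [eq_neg_of_add_eq_zero_left hsplit]
      exact hdvd.neg_right
    exact (mul_dvd_mul_iff_left (pow_ne_zero _ X_ne_zero)).1 h1
  have hfp : f * (f ^ (p / 2)) ^ 2 = expand (ZMod p) p f := by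
    rw [ZMod.expand_card, ← pow_mul, ← pow_succ']
    congr 1
    have := (Fact.out : p.Prime).eq_two_or_odd
    lia
  have hexp : X ^ p ∣ expand (ZMod p) p f - C (f.coeff 0) := by
    have : X ∣ f - C (f.coeff 0) := by rw [X_dvd_iff]; simp
    obtain ⟨g, hg⟩ := this
    have := congrArg (expand (ZMod p) p) hg
    rw [map_sub, map_mul, expand_X, expand_C] at this
    exact ⟨_, this⟩
  have hkey : X ^ p ∣ r j₀ ^ 2 * f - C (f.coeff 0) * s j₀ ^ 2 := by
    have : r j₀ ^ 2 * f - C (f.coeff 0) * s j₀ ^ 2 =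
        (r j₀ + s j₀ * f ^ (p / 2)) * ((r j₀ - s j₀ * f ^ (p / 2)) * f) +
        s j₀ ^ 2 * (expand (ZMod p) p f - C (f.coeff 0)) := by
      rw [← hfp]; ring
    rw [this]
    exact dvd_add (hdvd2.mul_right _) (hexp.mul_left _)
  have hzero : r j₀ ^ 2 * f - C (f.coeff 0) * s j₀ ^ 2 = 0 := by
    by_contra hne0
    have hle := natDegree_le_of_dvd hkey hne0
    rw [natDegree_X_pow] at hle
    have hp0 := (Fact.out : p.Prime).pos
    have hrd : r j₀ ≠ 0 → (r j₀).natDegree < A := fun h => (natDegree_lt_iff_degree_lt h).2 (hr _)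
    have hsd : s j₀ ≠ 0 → (s j₀).natDegree < A := fun h => (natDegree_lt_iff_degree_lt h).2 (hs _)
    have hA0 : 0 < A := by
      rcases hj₀ne with h | h
      · exact (Nat.zero_le _).trans_lt (hrd h)
      · exact (Nat.zero_le _).trans_lt (hsd h)
    have hrd' : (r j₀).natDegree + 1 ≤ A := by
      by_cases h : r j₀ = 0
      · simpa [h] using Nat.succ_le_of_lt hA0
      · exact hrd h
    have hsd' : (s j₀).natDegree + 1 ≤ A := by
      by_cases h : s j₀ = 0
      · simpa [h] using Nat.succ_le_of_lt hA0
      · exact hsd h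
    have h1 : (r j₀ ^ 2 * f).natDegree ≤ 2 * (r j₀).natDegree + f.natDegree :=
      natDegree_mul_le.trans (by gcongr; exact natDegree_pow_le)
    have h2 : (C (f.coeff 0) * s j₀ ^ 2).natDegree ≤ 2 * (s j₀).natDegree :=
      (natDegree_C_mul_le _ _).trans natDegree_pow_le
    have h3 := natDegree_sub_le (r j₀ ^ 2 * f) (C (f.coeff 0) * s j₀ ^ 2)
    have := le_max_iff.1 h3
    lia
  have heq : r j₀ ^ 2 * f = C (f.coeff 0) * s j₀ ^ 2 := sub_eq_zero.1 hzero
  have hC : C (f.coeff 0) ≠ 0 := by simpa using h0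
  have hr0 : r j₀ ≠ 0 := by
    intro h
    rcases hj₀ne with h' | h'
    · exact h' h
    · rw [h] at heq
      have : C (f.coeff 0) * s j₀ ^ 2 = 0 := by rw [← heq]; simp
      rcases mul_eq_zero.1 this with h'' | h''
      · exact hC h''
      · exact h' (pow_eq_zero_iff (two_ne_zero)|>.1 h'')
  have hs0 : s j₀ ≠ 0 := by
    intro h
    rw [h] at heq
    have : r j₀ ^ 2 * f = 0 := by rw [heq]; simp
    rcases mul_eq_zero.1 this with h'' | h''
    · exact hr0 (pow_eq_zero_iff (two_ne_zero)|>.1 h'')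
    · exact hf0 h''
  have hmult := congrArg (rootMultiplicity α) heq
  rw [rootMultiplicity_mul (mul_ne_zero (pow_ne_zero _ hr0) hf0),
    rootMultiplicity_mul (mul_ne_zero hC (pow_ne_zero _ hs0)), rootMultiplicity_C, sq, sq,
    rootMultiplicity_mul (mul_ne_zero hr0 hr0), rootMultiplicity_mul (mul_ne_zero hs0 hs0)] at hmult
  obtain ⟨k, hk⟩ := hα
  lia

/-- The number of `x` with `f x ^ ((p - 1) / 2) = a ≠ 0`, bounded by an auxiliary polynomial that
vanishes to order `l` at each of them. -/
lemma card_mul_le_of_auxiliary (f : (ZMod p)[X]) (hp : p ≠ 2) {α : ZMod p}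
    (hα : Odd (f.rootMultiplicity α)) (h0 : f.coeff 0 ≠ 0) {A J l : ℕ}
    (hA : 2 * A + f.natDegree ≤ p) (hl : l < p)
    (hdim : l * (A + l * f.natDegree + J) < 2 * A * J) (a : ZMod p) :
    #{x : ZMod p | f.eval x ≠ 0 ∧ f.eval x ^ (p / 2) = a} * l ≤
      l * f.natDegree + A + f.natDegree * (p / 2) + J * p := by
  classical
  set d := f.natDegree with hd
  set n := p / 2 with hn
  set B := A + l * d + J with hB
  have hf0 : f ≠ 0 := by rintro rfl; simp at h0
  let V := Fin J → (degreeLT (ZMod p) A × degreeLT (ZMod p) A)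
  let R (j : Fin J) : V →ₗ[ZMod p] (ZMod p)[X] :=
    (degreeLT (ZMod p) A).subtype ∘ₗ LinearMap.fst _ _ _ ∘ₗ LinearMap.proj j
  let S (j : Fin J) : V →ₗ[ZMod p] (ZMod p)[X] :=
    (degreeLT (ZMod p) A).subtype ∘ₗ LinearMap.snd _ _ _ ∘ₗ LinearMap.proj j
  let Ψ (k : ℕ) : V →ₗ[ZMod p] (ZMod p)[X] :=
    ∑ j : Fin J, LinearMap.mulLeft (ZMod p) (X ^ (j : ℕ)) ∘ₗ
      (powMulDeriv f l k ∘ₗ R j + a • powMulDeriv f (l + n) k ∘ₗ S j)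
  let Φ : V →ₗ[ZMod p] (Fin l → Fin B → ZMod p) :=
    LinearMap.pi fun k => LinearMap.pi fun i => lcoeff (ZMod p) i ∘ₗ Ψ k
  have hfinA : Module.finrank (ZMod p) (degreeLT (ZMod p) A) = A := by
    rw [(degreeLTEquiv (ZMod p) A).finrank_eq]; simp
  have : FiniteDimensional (ZMod p) (degreeLT (ZMod p) A) :=
    Module.Finite.equiv (degreeLTEquiv (ZMod p) A).symm
  have hker : LinearMap.ker Φ ≠ ⊥ := by
    apply LinearMap.ker_ne_bot_of_finrank_lt
    have h1 : Module.finrank (ZMod p) V = J * (A + A) := by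
      simp only [V]
      rw [Module.finrank_pi_fintype]
      simp [Module.finrank_prod, hfinA]
    have h2 : Module.finrank (ZMod p) (Fin l → Fin B → ZMod p) = l * B := by
      rw [Module.finrank_pi_fintype]
      simp
    rw [h1, h2]
    calc l * B < 2 * A * J := hdim
      _ = J * (A + A) := by ring
  obtain ⟨v, hv, hv0⟩ := Submodule.exists_mem_ne_zero_of_ne_bot hker
  rw [LinearMap.mem_ker] at hv
  have hRdeg : ∀ j, (R j v).degree < A := fun j => mem_degreeLT.1 (v j).1.2
  have hSdeg : ∀ j, (S j v).degree < A := fun j => mem_degreeLT.1 (v j).2.2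
  have hnat : ∀ q : (ZMod p)[X], q.degree < A → q.natDegree ≤ A := fun q hq =>
    natDegree_le_iff_degree_le.2 hq.le
  have hΨ : ∀ k < l, Ψ k v = 0 := by
    intro k hk
    have hdeg : (Ψ k v).degree < B := by
      simp only [Ψ, LinearMap.sum_apply]
      refine (degree_sum_le _ _).trans_lt ?_
      rw [Finset.sup_lt_iff (by exact_mod_cast WithBot.bot_lt_coe B)]
      intro j _
      simp only [LinearMap.comp_apply, LinearMap.add_apply, LinearMap.smul_apply,
        LinearMap.mulLeft_apply]
      have h1 := natDegree_powMulDeriv_le f (R j v) l k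
      have h2 := natDegree_powMulDeriv_le f (S j v) (l + n) k
      have h3 := hnat _ (hRdeg j)
      have h4 := hnat _ (hSdeg j)
      have h5 : k * d ≤ l * d := Nat.mul_le_mul_right _ hk.le
      have h6 : (powMulDeriv f l k (R j v) + a • powMulDeriv f (l + n) k (S j v)).natDegree ≤
          A + l * d := by
        refine (natDegree_add_le _ _).trans (max_le (by lia) ?_)
        refine (natDegree_smul_le _ _).trans (by lia)
      refine lt_of_le_of_lt degree_le_natDegree ?_
      refine Nat.cast_lt.2 (lt_of_le_of_lt natDegree_mul_le ?_)
      rw [natDegree_X_pow]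
      have := j.2
      lia
    ext i
    by_cases hi : i < B
    · have := congrFun (congrFun hv ⟨k, hk⟩) ⟨i, hi⟩
      simpa [Φ] using this
    · rw [coeff_zero]
      exact coeff_eq_zero_of_degree_lt (hdeg.trans_le (by exact_mod_cast not_lt.1 hi))
  let r (j : ℕ) : (ZMod p)[X] := if h : j < J then R ⟨j, h⟩ v else 0
  let s (j : ℕ) : (ZMod p)[X] := if h : j < J then S ⟨j, h⟩ v else 0
  have hr : ∀ j, (r j).degree < A := by
    intro j
    by_cases h : j < J
    · simpa [r, h] using hRdeg ⟨j, h⟩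
    · simp [r, h]
  have hs : ∀ j, (s j).degree < A := by
    intro j
    by_cases h : j < J
    · simpa [s, h] using hSdeg ⟨j, h⟩
    · simp [s, h]
  have hne : ∃ j < J, r j ≠ 0 ∨ s j ≠ 0 := by
    by_contra! hcon
    apply hv0
    funext j
    have := hcon j j.2
    simp only [r, s, j.2, dif_pos] at this
    exact Prod.ext (Subtype.ext this.1) (Subtype.ext this.2)
  set G := ∑ j ∈ range J, X ^ (p * j) * (r j + s j * f ^ n) with hG
  have hGne : G ≠ 0 := sum_X_pow_mul_ne_zero f hp hα h0 hA r s hr hs hne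
  have hFne : f ^ l * G ≠ 0 := mul_ne_zero (pow_ne_zero _ hf0) hGne
  have hF : f ^ l * G = ∑ j ∈ range J,
      X ^ (p * j) * (f ^ l * r j + f ^ (l + n) * s j) := by
    rw [hG, mul_sum]
    refine sum_congr rfl fun j _ => ?_
    ring
  have hroot : ∀ x : ZMod p, f.eval x ≠ 0 → f.eval x ^ n = a → ∀ k < l,
      (derivative^[k] (f ^ l * G)).IsRoot x := by
    intro x _ hxa k hk
    have hk1 : l + n - k = (l - k) + n := by lia
    rw [hF, iterate_derivative_sum, IsRoot, eval_finsetSum]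
    have hterm : ∀ j ∈ range J,
        eval x (derivative^[k] (X ^ (p * j) * (f ^ l * r j + f ^ (l + n) * s j))) =
        eval x f ^ (l - k) * eval x (X ^ j * (powMulDeriv f l k (r j) +
          a • powMulDeriv f (l + n) k (s j))) := by
      intro j _
      rw [iterate_derivative_X_pow_mul, iterate_map_add,
        iterate_derivative_pow_mul f _ hk.le, iterate_derivative_pow_mul f _ (by lia), hk1]
      simp only [eval_mul, eval_add, eval_pow, eval_X, eval_smul, smul_eq_mul, pow_add, hxa,
        pow_mul, ZMod.pow_card]
      ring
    rw [sum_congr rfl hterm, ← mul_sum, ← eval_finsetSum]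
    have : ∑ j ∈ range J, X ^ j * (powMulDeriv f l k (r j) +
        a • powMulDeriv f (l + n) k (s j)) = Ψ k v := by
      rw [← Fin.sum_univ_eq_sum_range (fun j => X ^ j * (powMulDeriv f l k (r j) +
        a • powMulDeriv f (l + n) k (s j)))]
      simp [Ψ, r, s]
    rw [this, hΨ k hk]
    simp
  have hmult : ∀ x ∈ ({x : ZMod p | f.eval x ≠ 0 ∧ f.eval x ^ n = a} : Finset (ZMod p)),
      l ≤ (f ^ l * G).roots.count x := by
    intro x hx
    rw [mem_filter] at hx
    rw [count_roots]
    rcases Nat.eq_zero_or_pos l with rfl | hl0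
    · exact Nat.zero_le _
    have := lt_rootMultiplicity_of_isRoot_iterate_derivative_of_mem_nonZeroDivisors (n := l - 1)
      hFne (fun m hm => hroot x hx.2.1 hx.2.2 m (by lia)) ?_
    · lia
    · rw [mem_nonZeroDivisors_iff_ne_zero, Ne, ZMod.natCast_eq_zero_iff,
        (Fact.out : p.Prime).dvd_factorial]
      lia
  calc #{x : ZMod p | f.eval x ≠ 0 ∧ f.eval x ^ n = a} * l
      ≤ ∑ x ∈ ({x : ZMod p | f.eval x ≠ 0 ∧ f.eval x ^ n = a} : Finset (ZMod p)),
          (f ^ l * G).roots.count x := by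
        rw [← smul_eq_mul]; exact card_nsmul_le_sum _ _ _ hmult
    _ ≤ ∑ x : ZMod p, (f ^ l * G).roots.count x :=
        sum_le_sum_of_subset (subset_univ _)
    _ = (f ^ l * G).roots.card := by
        rw [Multiset.sum_count_eq_card]; simp
    _ ≤ (f ^ l * G).natDegree := card_roots' _
    _ ≤ l * d + G.natDegree := natDegree_mul_le.trans (by gcongr; exact natDegree_pow_le)
    _ ≤ l * d + (A + d * n + J * p) := by
        gcongr
        refine natDegree_sum_le_of_forall_le _ _ fun j hj => ?_
        have h1 : (r j + s j * f ^ n).natDegree ≤ A + d * n := by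
          refine (natDegree_add_le _ _).trans (max_le ((hnat _ (hr j)).trans (by lia)) ?_)
          refine natDegree_mul_le.trans (Nat.add_le_add (hnat _ (hs j)) ?_)
          rw [mul_comm]
          exact natDegree_pow_le
        refine natDegree_mul_le.trans ?_
        rw [natDegree_X_pow]
        have : p * j ≤ J * p := by
          rw [mul_comm]; exact Nat.mul_le_mul_right _ (mem_range.1 hj).le
        lia
    _ = l * d + A + d * n + J * p := by ring

lemma two_mul_card_le (f : (ZMod p)[X]) {α : ZMod p}
    (hα : Odd (f.rootMultiplicity α)) (h0 : f.coeff 0 ≠ 0)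
    (hd : 100 * f.natDegree ≤ √p) (hd1 : 1 ≤ f.natDegree) (a : ZMod p) :
    2 * (#{x : ZMod p | f.eval x ≠ 0 ∧ f.eval x ^ (p / 2) = a} : ℝ) ≤
      p + 20 * f.natDegree * √p := by
  set d := f.natDegree with hd_def
  set lam := Nat.sqrt p with hlam
  have h1 : lam * lam ≤ p := Nat.sqrt_le p
  have h2 : p < (lam + 1) * (lam + 1) := Nat.lt_succ_sqrt p
  have hsq : √(p : ℝ) ^ 2 = p := Real.sq_sqrt (Nat.cast_nonneg p)
  have hsqlt : √(p : ℝ) < lam + 1 := by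
    rw [Real.sqrt_lt' (by positivity)]
    have : (p : ℝ) < ((lam + 1) * (lam + 1) : ℕ) := by exact_mod_cast h2
    push_cast at this
    linarith
  have hd1' : (1 : ℝ) ≤ d := by exact_mod_cast hd1
  have hlamd : 100 * d ≤ lam := by
    have : (100 * d : ℝ) < lam + 1 := hd.trans_lt hsqlt
    have : 100 * d < lam + 1 := by exact_mod_cast this
    lia
  have hlarge : 100 * lam ≤ p := by nlinarith
  have hp2 : p ≠ 2 := by lia
  have hkey := card_mul_le_of_auxiliary (A := (p - d) / 2) (J := lam + 18 * d) (l := 2 * lam)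
    f hp2 hα h0 (by lia) (by lia) (by
      obtain ⟨A, hA⟩ : ∃ A, A = (p - d) / 2 := ⟨_, rfl⟩
      have hA2 : p ≤ 2 * A + d + 1 := by lia
      rw [← hA, ← hd_def]
      have : lam * (2 * lam * d + lam + 18 * d) < 18 * A * d := by
        have e1 : lam * (2 * lam * d + lam + 18 * d) ≤ d * (3 * p + 18 * lam) := by nlinarith
        have e2 : 3 * p + 18 * lam < 18 * A := by lia
        nlinarith
      nlinarith) a
  set N := #{x : ZMod p | f.eval x ≠ 0 ∧ f.eval x ^ (p / 2) = a}
  have hkey' : (N : ℝ) * (2 * lam) ≤ 2 * lam * d + p / 2 + d * (p / 2) + (lam + 18 * d) * p := by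
    have : N * (2 * lam) * 2 ≤ 4 * lam * d + p + d * p + 2 * ((lam + 18 * d) * p) := by
      have e1 : 2 * (d * (p / 2)) ≤ d * p := by
        calc 2 * (d * (p / 2)) = d * (2 * (p / 2)) := by ring
          _ ≤ d * p := by gcongr; lia
      have e2 : 2 * ((p - d) / 2) ≤ p := by lia
      rw [← hd_def] at hkey
      linarith
    have : ((N * (2 * lam) * 2 : ℕ) : ℝ) ≤
      ((4 * lam * d + p + d * p + 2 * ((lam + 18 * d) * p) : ℕ) : ℝ) := by exact_mod_cast this
    push_cast at this
    linarith
  set t := √(p : ℝ) with ht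
  have ht100 : 100 ≤ t := by linarith
  have hlam0 : 99 / 100 * t ≤ lam := by linarith
  have hlampos : (0 : ℝ) < lam := by linarith
  refine le_of_mul_le_mul_right ?_ hlampos
  rw [← hsq] at hkey' ⊢
  have e3 : t ^ 2 ≤ d * t ^ 2 := le_mul_of_one_le_left (by positivity) hd1'
  have e4 : 2 * (lam : ℝ) ≤ t ^ 2 / 10 := by
    have : (lam : ℝ) ≤ t := by
      rw [ht]; apply Real.le_sqrt_of_sq_le
      have : ((lam * lam : ℕ) : ℝ) ≤ p := by exact_mod_cast h1
      push_cast at this; linarith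
    nlinarith
  have e5 : 2 * (lam : ℝ) * d ≤ d * (t ^ 2 / 10) := by nlinarith
  have e6 : 20 * (d : ℝ) * t * (99 / 100 * t) ≤ 20 * d * t * lam := by gcongr
  have e7 : (0 : ℝ) ≤ d * t ^ 2 := by positivity
  nlinarith

lemma abs_sum_quadraticChar_le_of_coeff_zero_ne_zero (f : (ZMod p)[X]) {α : ZMod p}
    (hα : Odd (f.rootMultiplicity α)) (h0 : f.coeff 0 ≠ 0)
    (hd : 100 * f.natDegree ≤ √p) (hd1 : 1 ≤ f.natDegree) :
    |((∑ x, quadraticChar (ZMod p) (f.eval x) : ℤ) : ℝ)| ≤ 100 * f.natDegree * √p := by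
  have hf0 : f ≠ 0 := by rintro rfl; simp at h0
  have hd1' : (1 : ℝ) ≤ f.natDegree := by exact_mod_cast hd1
  have hsq : √(p : ℝ) ^ 2 = p := Real.sq_sqrt (Nat.cast_nonneg p)
  have hp2 : p ≠ 2 := by
    rintro rfl
    push_cast at hsq hd
    nlinarith
  have hchar : ringChar (ZMod p) ≠ 2 := by rwa [ZMod.ringChar_zmod_n]
  have h11 : (1 : ZMod p) ≠ -1 := (Ring.neg_one_ne_one_of_char_ne_two hchar).symm
  set P : Finset (ZMod p) := {x | f.eval x ≠ 0 ∧ f.eval x ^ (p / 2) = 1} with hP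
  set M : Finset (ZMod p) := {x | f.eval x ≠ 0 ∧ f.eval x ^ (p / 2) = -1} with hM
  set Z : Finset (ZMod p) := {x | f.eval x = 0} with hZ
  have hpow : ∀ x : ZMod p, x ≠ 0 → x ^ (p / 2) = 1 ∨ x ^ (p / 2) = -1 :=
    fun x hx => ZMod.pow_div_two_eq_neg_one_or_one p hx
  have hval : ∀ x, quadraticChar (ZMod p) (f.eval x) =
      (if x ∈ P then 1 else 0) - (if x ∈ M then 1 else 0) := by
    intro x
    by_cases hx : f.eval x = 0
    · simp [hP, hM, hx]
    · rw [quadraticChar_eq_pow_of_char_ne_two hchar hx, ZMod.card]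
      rcases hpow _ hx with h | h
      · simp [hP, hM, hx, h, h11]
      · simp [hP, hM, hx, h, h11.symm]
  have hone : ∀ x : ZMod p, (1 : ℕ) =
      (if x ∈ P then 1 else 0) + (if x ∈ M then 1 else 0) + (if x ∈ Z then 1 else 0) := by
    intro x
    by_cases hx : f.eval x = 0
    · simp [hP, hM, hZ, hx]
    · rcases hpow _ hx with h | h
      · simp [hP, hM, hZ, hx, h, h11]
      · simp [hP, hM, hZ, hx, h, h11.symm]
  have hsum : (∑ x, quadraticChar (ZMod p) (f.eval x) : ℤ) = #P - #M := by
    simp_rw [hval]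
    rw [sum_sub_distrib]
    simp
  have hcard : p = #P + #M + #Z := by
    have := sum_congr (rfl : (univ : Finset (ZMod p)) = univ) fun x _ => hone x
    rw [sum_add_distrib, sum_add_distrib] at this
    simpa [ZMod.card] using this
  have hZd : #Z ≤ f.natDegree := by
    have : Z ⊆ f.roots.toFinset := by
      intro x hx
      simpa [hZ, hf0] using hx
    exact (card_le_card this).trans ((Multiset.toFinset_card_le _).trans (card_roots' _))
  have h1 := two_mul_card_le f hα h0 hd hd1 1
  have h2 := two_mul_card_le f hα h0 hd hd1 (-1)
  have hcard' : (p : ℝ) = #P + #M + #Z := by exact_mod_cast hcard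
  have hZd' : (#Z : ℝ) ≤ f.natDegree := by exact_mod_cast hZd
  have ht : (f.natDegree : ℝ) ≤ f.natDegree * √p :=
    le_mul_of_one_le_right (by positivity) (by linarith)
  rw [hsum, abs_le]
  push_cast
  constructor <;> linarith

/-- Weil's bound for sums of the quadratic character, with a weaker constant. -/
theorem abs_sum_quadraticChar_eval_le (f : (ZMod p)[X]) {α : ZMod p}
    (hα : Odd (f.rootMultiplicity α)) :
    |((∑ x, quadraticChar (ZMod p) (f.eval x) : ℤ) : ℝ)| ≤ 100 * f.natDegree * √p := by
  have hf0 : f ≠ 0 := by rintro rfl; simp at hα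
  have hd1 : 1 ≤ f.natDegree := by
    have h1 := hα.pos
    rw [← count_roots] at h1
    exact h1.trans_le ((Multiset.count_le_card _ _).trans (card_roots' f))
  have hsq : √(p : ℝ) ^ 2 = p := Real.sq_sqrt (Nat.cast_nonneg p)
  have hd1' : (1 : ℝ) ≤ f.natDegree := by exact_mod_cast hd1
  by_cases hd : 100 * f.natDegree ≤ √p
  · have hlt : f.natDegree < p := by
      have : (f.natDegree : ℝ) < p := by nlinarith
      exact_mod_cast this
    obtain ⟨c, hc⟩ : ∃ c : ZMod p, f.eval c ≠ 0 := by
      by_contra! hcon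
      refine hf0 (eq_zero_of_natDegree_lt_card_of_eval_eq_zero' f univ (fun x _ => hcon x) ?_)
      simpa [ZMod.card] using hlt
    have hdeg : (f.comp (X + C c)).natDegree = f.natDegree := by
      rw [natDegree_comp, natDegree_X_add_C, mul_one]
    have hmul : (f.comp (X + C c)).rootMultiplicity (α - c) = f.rootMultiplicity α := by
      rw [rootMultiplicity_eq_rootMultiplicity, rootMultiplicity_eq_rootMultiplicity (p := f),
        comp_assoc]
      congr 2
      simp [add_assoc]
    have := abs_sum_quadraticChar_le_of_coeff_zero_ne_zero (f.comp (X + C c)) (α := α - c)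
      (by rwa [hmul]) (by rw [coeff_zero_eq_eval_zero]; simpa using hc) (by rwa [hdeg])
      (by rwa [hdeg])
    rw [hdeg] at this
    rw [← Equiv.sum_comp (Equiv.addRight c) fun x => quadraticChar (ZMod p) (f.eval x)]
    simpa only [eval_comp, eval_add, eval_X, eval_C, Equiv.coe_addRight] using this
  · push Not at hd
    calc |((∑ x, quadraticChar (ZMod p) (f.eval x) : ℤ) : ℝ)|
        ≤ ∑ x : ZMod p, (1 : ℝ) := by
          push_cast
          refine (abs_sum_le_sum_abs _ _).trans (sum_le_sum fun x _ => ?_)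
          rcases quadraticChar_isQuadratic (ZMod p) (f.eval x) with h | h | h <;> simp [h]
      _ = √p * √p := by simp [ZMod.card]
      _ ≤ 100 * f.natDegree * √p := by gcongr

end Stepanov

section Moments

open Polynomial

variable {p : ℕ} [Fact p.Prime]

lemma rootMultiplicity_prod_X_add_C {ι : Type*} (s : Finset ι) (m : ι → ZMod p) (a : ZMod p) :
    (∏ i ∈ s, (X + C (m i))).rootMultiplicity (-a) = #{i ∈ s | m i = a} := by
  classical
  induction s using Finset.induction_on with
  | empty => simp
  | insert i s hi ih =>
    have h1 : ∀ i, X + C (m i) ≠ 0 := fun i => X_add_C_ne_zero _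
    rw [prod_insert hi, rootMultiplicity_mul (mul_ne_zero (h1 i) (prod_ne_zero_iff.2 fun i _ => h1 i)),
      ih, filter_insert]
    have h2 : (X + C (m i)).rootMultiplicity (-a) = if m i = a then 1 else 0 := by
      rw [show X + C (m i) = X - C (-m i) by simp, rootMultiplicity_X_sub_C]
      simp [neg_inj, eq_comm]
    rw [h2]
    split_ifs with h
    · rw [card_insert_of_notMem (by simp [hi]), add_comm]
    · simp

lemma abs_sum_prod_quadraticChar_le {ι : Type*} (s : Finset ι) (m : ι → ZMod p) (a : ZMod p)
    (ha : Odd #{i ∈ s | m i = a}) :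
    |((∑ y, ∏ i ∈ s, quadraticChar (ZMod p) (y + m i) : ℤ) : ℝ)| ≤ 100 * #s * √p := by
  rw [← rootMultiplicity_prod_X_add_C] at ha
  have h := abs_sum_quadraticChar_eval_le _ ha
  have hdeg : (∏ i ∈ s, (X + C (m i))).natDegree = #s := by
    rw [natDegree_prod _ _ fun i _ => X_add_C_ne_zero _]
    simp
  rw [hdeg] at h
  simpa [eval_prod, map_prod] using h

/-- Few `y` start a window of length `M` on which the quadratic character is constant. -/
lemma card_constant_window_le {M : ℕ} (hM : M ≤ p) {ε : ℤ} (hε : ε = 1 ∨ ε = -1) :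
    (#{y : ZMod p | ∀ m ∈ range M, quadraticChar (ZMod p) (y + m) = ε} : ℝ) * 2 ^ M ≤
      p + 2 ^ M * (100 * M * √p) := by
  classical
  have hεε : ε * ε = 1 := by rcases hε with rfl | rfl <;> norm_num
  set χ := quadraticChar (ZMod p)
  set Y : Finset (ZMod p) := {y : ZMod p | ∀ m ∈ range M, χ (y + m) = ε}
  have hnonneg : ∀ (y : ZMod p) (m : ℕ), 0 ≤ 1 + ε * χ (y + m) := by
    intro y m
    rcases hε with rfl | rfl <;>
    rcases quadraticChar_isQuadratic (ZMod p) (y + m) with h | h | h <;> simp [χ, h]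
  have hlow : (#Y : ℤ) * 2 ^ M ≤ ∑ y : ZMod p, ∏ m ∈ range M, (1 + ε * χ (y + m)) := by
    calc (#Y : ℤ) * 2 ^ M = ∑ y ∈ Y, ∏ m ∈ range M, (1 + ε * χ (y + m)) := by
          rw [← smul_eq_mul, Nat.cast_smul_eq_nsmul, ← sum_const]
          refine sum_congr rfl fun y hy => ?_
          rw [prod_congr rfl (g := fun _ => (2 : ℤ)), prod_const, card_range]
          intro m hm
          rw [(mem_filter.1 hy).2 m hm, hεε]
          norm_num
      _ ≤ _ := sum_le_sum_of_subset_of_nonneg (subset_univ _) fun y _ _ =>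
          prod_nonneg fun m _ => hnonneg y m
  have hexp : ∑ y : ZMod p, ∏ m ∈ range M, (1 + ε * χ (y + m)) =
      ∑ S ∈ (range M).powerset, ε ^ #S * ∑ y : ZMod p, ∏ m ∈ S, χ (y + m) := by
    simp_rw [Finset.prod_one_add]
    rw [sum_comm]
    refine sum_congr rfl fun S _ => ?_
    rw [mul_sum]
    exact sum_congr rfl fun y _ => by rw [prod_mul_distrib, prod_const]
  have hterm : ∀ S ∈ (range M).powerset.erase ∅,
      ((ε ^ #S * ∑ y : ZMod p, ∏ m ∈ S, χ (y + m) : ℤ) : ℝ) ≤ 100 * M * √p := by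
    intro S hS
    rw [mem_erase, mem_powerset] at hS
    obtain ⟨m₀, hm₀⟩ := nonempty_iff_ne_empty.2 hS.1
    have hone : #{i ∈ S | ((i : ℕ) : ZMod p) = m₀} = 1 := by
      rw [card_eq_one]
      refine ⟨m₀, ?_⟩
      ext i
      simp only [mem_filter, mem_singleton]
      constructor
      · rintro ⟨hi, hi'⟩
        have h1 := mem_range.1 (hS.2 hi)
        have h2 := mem_range.1 (hS.2 hm₀)
        rw [ZMod.natCast_eq_natCast_iff'] at hi'
        rwa [Nat.mod_eq_of_lt (by lia), Nat.mod_eq_of_lt (by lia)] at hi'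
      · rintro rfl
        exact ⟨hm₀, rfl⟩
    have := abs_sum_prod_quadraticChar_le S (fun i => ((i : ℕ) : ZMod p)) m₀ (by rw [hone]; simp)
    have hcard : (#S : ℝ) ≤ M := by
      have := card_le_card hS.2
      rw [card_range] at this
      exact_mod_cast this
    have habs : |((ε ^ #S : ℤ) : ℝ)| = 1 := by
      rcases hε with rfl | rfl <;> simp
    rw [Int.cast_mul]
    refine (le_abs_self _).trans ?_
    rw [abs_mul, habs, one_mul]
    exact this.trans (by gcongr)
  have hmain : ((∑ S ∈ (range M).powerset, ε ^ #S * ∑ y : ZMod p, ∏ m ∈ S, χ (y + m) : ℤ) : ℝ) ≤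
      p + 2 ^ M * (100 * M * √p) := by
    rw [← add_sum_erase _ _ (empty_mem_powerset (range M)), Int.cast_add, Int.cast_sum]
    have h1 : (((ε ^ #(∅ : Finset ℕ) * ∑ y : ZMod p, ∏ m ∈ (∅ : Finset ℕ), χ (y + m) : ℤ)) : ℝ) =
        p := by simp [ZMod.card]
    rw [h1]
    gcongr
    refine (sum_le_card_nsmul _ _ _ hterm).trans ?_
    rw [nsmul_eq_mul]
    gcongr
    have := card_le_card (erase_subset ∅ (range M).powerset)
    rw [card_powerset, card_range] at this
    exact_mod_cast this
  rw [← hexp] at hmain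
  have : ((#Y : ℤ) * 2 ^ M : ℝ) ≤ _ := le_trans (by exact_mod_cast hlow) hmain
  simpa using this

lemma exists_odd_or_paired (g : Fin 4 → ℕ) :
    (∃ i, Odd #{j | g j = g i}) ∨ (g 0 = g 1 ∧ g 2 = g 3) ∨ (g 0 = g 2 ∧ g 1 = g 3) ∨
      (g 0 = g 3 ∧ g 1 = g 2) := by
  by_contra! hcon
  obtain ⟨h, h1, h2, h3⟩ := hcon
  have e0 := h 0
  have e1 := h 1
  have e2 := h 2
  have e3 := h 3
  simp only [card_filter, Fin.sum_univ_four] at e0 e1 e2 e3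
  grind

/-- The fourth moment of sums of the quadratic character over short intervals. -/
lemma sum_pow_four_le {M : ℕ} (hM : M ≤ p) :
    ((∑ y : ZMod p, (∑ m ∈ range M, quadraticChar (ZMod p) (y + m)) ^ 4 : ℤ) : ℝ) ≤
      3 * M ^ 2 * p + M ^ 4 * (400 * √p) := by
  classical
  set χ := quadraticChar (ZMod p)
  have hexp : ∑ y : ZMod p, (∑ m ∈ range M, χ (y + m)) ^ 4 =
      ∑ g ∈ Fintype.piFinset (fun _ : Fin 4 => range M), ∑ y : ZMod p, ∏ i, χ (y + g i) := by
    rw [sum_comm]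
    refine sum_congr rfl fun y _ => ?_
    rw [← prod_univ_sum (fun _ : Fin 4 => range M) fun _ m => χ (y + m)]
    simp
  set P : Finset (Fin 4 → ℕ) := (Fintype.piFinset (fun _ : Fin 4 => range M)).filter
    fun g => ∃ i, Odd #{j | g j = g i}
  set U : Finset (Fin 4 → ℕ) := (Fintype.piFinset (fun _ : Fin 4 => range M)).filter
    fun g => ¬ ∃ i, Odd #{j | g j = g i}
  have hU : #U ≤ 3 * M ^ 2 := by
    have hsub : U ⊆ (range M ×ˢ range M).image (fun a => ![a.1, a.1, a.2, a.2]) ∪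
        ((range M ×ˢ range M).image (fun a => ![a.1, a.2, a.1, a.2]) ∪
        (range M ×ˢ range M).image (fun a => ![a.1, a.2, a.2, a.1])) := by
      intro g hg
      rw [mem_filter, Fintype.mem_piFinset] at hg
      have hform : g = ![g 0, g 1, g 2, g 3] := by
        funext i; fin_cases i <;> rfl
      rw [mem_union, mem_union, mem_image, mem_image, mem_image]
      rcases (exists_odd_or_paired g).resolve_left hg.2 with h | h | h
      · exact Or.inl ⟨(g 0, g 2), mem_product.2 ⟨hg.1 0, hg.1 2⟩, by
          conv_rhs => rw [hform, ← h.1, ← h.2]⟩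
      · exact Or.inr (Or.inl ⟨(g 0, g 1), mem_product.2 ⟨hg.1 0, hg.1 1⟩, by
          conv_rhs => rw [hform, ← h.1, ← h.2]⟩)
      · exact Or.inr (Or.inr ⟨(g 0, g 1), mem_product.2 ⟨hg.1 0, hg.1 1⟩, by
          conv_rhs => rw [hform, ← h.1, ← h.2]⟩)
    have hc : ∀ F : ℕ × ℕ → Fin 4 → ℕ, #((range M ×ˢ range M).image F) ≤ M ^ 2 := fun F =>
      card_image_le.trans (by simp [sq])
    calc #U ≤ _ := card_le_card hsub
      _ ≤ M ^ 2 + (M ^ 2 + M ^ 2) := (card_union_le _ _).trans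
          (Nat.add_le_add (hc _) ((card_union_le _ _).trans (Nat.add_le_add (hc _) (hc _))))
      _ = 3 * M ^ 2 := by ring
  have hP : #P ≤ M ^ 4 := (card_filter_le _ _).trans (by simp)
  have htriv : ∀ g ∈ U, ((∑ y : ZMod p, ∏ i, χ (y + g i) : ℤ) : ℝ) ≤ p := by
    intro g _
    have : ∑ y : ZMod p, ∏ i, χ (y + g i) ≤ ∑ y : ZMod p, 1 := by
      refine sum_le_sum fun y _ => ?_
      refine (le_abs_self _).trans ?_
      rw [abs_prod]
      refine prod_le_one (fun _ _ => abs_nonneg _) fun i _ => ?_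
      rcases quadraticChar_isQuadratic (ZMod p) (y + g i) with h | h | h <;> simp [χ, h]
    rw [sum_const, card_univ, ZMod.card] at this
    have h2 : (((∑ y : ZMod p, ∏ i, χ (y + g i) : ℤ)) : ℝ) ≤ ((p • 1 : ℤ) : ℝ) := by
      exact_mod_cast this
    simpa using h2
  have hweil : ∀ g ∈ P, ((∑ y : ZMod p, ∏ i, χ (y + g i) : ℤ) : ℝ) ≤ 400 * √p := by
    intro g hg
    rw [mem_filter, Fintype.mem_piFinset] at hg
    obtain ⟨i, hi⟩ := hg.2
    have := abs_sum_prod_quadraticChar_le univ (fun i => ((g i : ℕ) : ZMod p)) (g i) (by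
      convert hi using 3 with j
      have h1 := mem_range.1 (hg.1 i)
      have h2 := mem_range.1 (hg.1 j)
      rw [ZMod.natCast_eq_natCast_iff', Nat.mod_eq_of_lt (by lia), Nat.mod_eq_of_lt (by lia)])
    refine (le_abs_self _).trans (this.trans ?_)
    simp only [card_univ, Fintype.card_fin]
    apply le_of_eq
    push_cast
    ring
  rw [hexp, ← sum_filter_add_sum_filter_not _ (fun g : Fin 4 → ℕ => ∃ i, Odd #{j | g j = g i}),
    Int.cast_add, add_comm, Int.cast_sum, Int.cast_sum]
  refine add_le_add ((sum_le_card_nsmul _ _ _ htriv).trans ?_)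
    ((sum_le_card_nsmul _ _ _ hweil).trans ?_)
  · rw [nsmul_eq_mul]
    gcongr
    exact_mod_cast hU
  · rw [nsmul_eq_mul]
    gcongr
    exact_mod_cast hP

end Moments

section Coprime

open Nat in
lemma primorial_primeFactors (n : ℕ) : (primorial n).primeFactors = primesLE n := by
  have h : primorial n = ∏ q ∈ primesLE n, q := by
    rw [primorial_eq_prod_primesLE]
  rw [h]
  exact Nat.primeFactors_prod fun q hq => Nat.prime_of_mem_primesLE hq

lemma primesLE_two_pow_dyadic (k : ℕ) :
    k * #{q ∈ Nat.primesLE (2 ^ (k + 1)) | 2 ^ k < q} ≤ 4 * 2 ^ k := by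
  set D := {q ∈ Nat.primesLE (2 ^ (k + 1)) | 2 ^ k < q}
  have h1 : (2 ^ k) ^ #D ≤ 4 ^ (2 ^ (k + 1)) :=
    calc (2 ^ k) ^ #D ≤ ∏ q ∈ D, q := pow_card_le_prod _ _ _ fun q hq => (mem_filter.1 hq).2.le
      _ ≤ ∏ q ∈ Nat.primesLE (2 ^ (k + 1)), q :=
          prod_le_prod_of_subset_of_one_le' (filter_subset _ _)
            fun q hq _ => (Nat.prime_of_mem_primesLE hq).one_le
      _ = primorial (2 ^ (k + 1)) := by rw [primorial_eq_prod_primesLE]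
      _ ≤ _ := primorial_le_four_pow _
  rw [show (4 : ℕ) = 2 ^ 2 by norm_num, ← pow_mul, ← pow_mul] at h1
  have := (Nat.pow_le_pow_iff_right (by norm_num)).1 h1
  rw [pow_succ] at this
  lia

lemma one_sub_inv_prime_pos {q n : ℕ} (hq : q ∈ Nat.primesLE n) : (0 : ℝ) < 1 - (q : ℝ)⁻¹ := by
  have : (1 : ℝ) < q := by exact_mod_cast (Nat.prime_of_mem_primesLE hq).one_lt
  have := inv_lt_one_of_one_lt₀ this
  linarith

lemma one_sub_sum_le_prod_one_sub {ι : Type*} (s : Finset ι) (x : ι → ℝ)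
    (h0 : ∀ i ∈ s, 0 ≤ x i) (h1 : ∀ i ∈ s, x i ≤ 1) :
    1 - ∑ i ∈ s, x i ≤ ∏ i ∈ s, (1 - x i) := by
  classical
  induction s using Finset.induction_on with
  | empty => simp
  | insert i s hi ih =>
    rw [sum_insert hi, prod_insert hi]
    have hP := ih (fun j hj => h0 j (mem_insert_of_mem hj)) fun j hj => h1 j (mem_insert_of_mem hj)
    have hP1 : ∏ j ∈ s, (1 - x j) ≤ 1 :=
      prod_le_one (fun j hj => sub_nonneg.2 (h1 j (mem_insert_of_mem hj)))
        fun j hj => by linarith [h0 j (mem_insert_of_mem hj)]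
    nlinarith [h0 i (mem_insert_self i s)]

/-- A Mertens-type lower bound for `∏ (1 - 1 / q)` over primes `q ≤ 2 ^ K`. -/
lemma exists_le_prod_one_sub_inv : ∃ c : ℝ, 0 < c ∧ ∀ K : ℕ, 5 ≤ K →
    c / K ^ 4 ≤ ∏ q ∈ Nat.primesLE (2 ^ K), (1 - (q : ℝ)⁻¹) := by
  set a : ℕ → ℝ := fun K => ∏ q ∈ Nat.primesLE (2 ^ K), (1 - (q : ℝ)⁻¹) with ha
  have hapos : ∀ K, 0 < a K := fun K => prod_pos fun q hq => one_sub_inv_prime_pos hq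
  have hstep : ∀ K : ℕ, 5 ≤ K → a K * (1 - 4 / K) ≤ a (K + 1) := by
    intro K hK
    have hK0 : (0 : ℝ) < K := by exact_mod_cast (by lia : 0 < K)
    have hsplit : a (K + 1) = a K *
        ∏ q ∈ Nat.primesLE (2 ^ (K + 1)) with 2 ^ K < q, (1 - (q : ℝ)⁻¹) := by
      rw [ha]
      dsimp only
      rw [← prod_filter_mul_prod_filter_not (Nat.primesLE (2 ^ (K + 1))) (fun q => 2 ^ K < q),
        mul_comm]
      congr 2
      ext q
      simp only [mem_filter, Nat.mem_primesLE, not_lt]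
      have : 2 ^ K ≤ 2 ^ (K + 1) := Nat.pow_le_pow_right (by norm_num) (by lia)
      constructor
      · rintro ⟨h, h'⟩; exact ⟨h', h.2⟩
      · rintro ⟨h, h'⟩; exact ⟨⟨h.trans this, h'⟩, h⟩
    rw [hsplit]
    refine mul_le_mul_of_nonneg_left ?_ (hapos K).le
    set D := {q ∈ Nat.primesLE (2 ^ (K + 1)) | 2 ^ K < q}
    have h1 : 1 - ∑ q ∈ D, (q : ℝ)⁻¹ ≤ ∏ q ∈ D, (1 - (q : ℝ)⁻¹) := by
      apply one_sub_sum_le_prod_one_sub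
      · intro q _; positivity
      · intro q hq
        have := one_sub_inv_prime_pos (mem_filter.1 hq).1
        linarith
    have h2 : ∑ q ∈ D, (q : ℝ)⁻¹ ≤ 4 / K := by
      have h3 : ∀ q ∈ D, (q : ℝ)⁻¹ ≤ (2 ^ K : ℝ)⁻¹ := by
        intro q hq
        have : (2 ^ K : ℝ) ≤ q := by exact_mod_cast (mem_filter.1 hq).2.le
        gcongr
      refine (sum_le_card_nsmul _ _ _ h3).trans ?_
      rw [nsmul_eq_mul, ← div_eq_mul_inv, div_le_div_iff₀ (by positivity) hK0]
      have : ((K * #D : ℕ) : ℝ) ≤ ((4 * 2 ^ K : ℕ) : ℝ) := by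
        exact_mod_cast primesLE_two_pow_dyadic K
      push_cast at this
      linarith
    linarith
  have hind : ∀ n : ℕ, a 5 * 24 / ((n + 4) * (n + 3) * (n + 2) * (n + 1)) ≤ a (n + 5) := by
    intro n
    induction n with
    | zero =>
      norm_num
    | succ n ih =>
      have h := hstep (n + 5) (by lia)
      have e : (1 - 4 / ((n + 5 : ℕ) : ℝ)) = (n + 1) / (n + 5) := by
        push_cast; field_simp; ring
      rw [e] at h
      have h' := mul_le_mul_of_nonneg_right ih (show (0 : ℝ) ≤ (n + 1) / (n + 5) by positivity)
      refine le_trans (le_of_eq ?_) (h'.trans h)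
      push_cast
      field_simp
      ring
  refine ⟨a 5 * 24, by have := hapos 5; positivity, fun K hK => ?_⟩
  obtain ⟨n, rfl⟩ : ∃ n, K = n + 5 := ⟨K - 5, by lia⟩
  refine le_trans ?_ (hind n)
  have := hapos 5
  gcongr
  push_cast
  have hn : (0 : ℝ) ≤ n := by positivity
  calc ((n : ℝ) + 4) * (n + 3) * (n + 2) * (n + 1)
      ≤ (n + 5) * (n + 5) * (n + 5) * (n + 5) := by gcongr <;> linarith
    _ = _ := by ring

lemma card_filter_coprime_Icc_ge (P Q : ℕ) :
    P.totient * (Q / P) ≤ #{q ∈ Icc 1 Q | P.Coprime q} := by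
  rcases Nat.eq_zero_or_pos P with rfl | hP
  · simp
  have hle : P * (Q / P) ≤ Q := Nat.mul_div_le Q P
  have key : ∀ m : ℕ, P.totient * m = #{q ∈ Ico 1 (1 + P * m) | P.Coprime q} := by
    intro m
    induction m with
    | zero => simp
    | succ m ih =>
      have hU : Ico 1 (1 + P * (m + 1)) = Ico 1 (1 + P * m) ∪ Ico (1 + P * m) (1 + P * m + P) := by
        rw [Ico_union_Ico_eq_Ico (by lia) (by lia)]
        congr 1
        ring
      rw [hU, filter_union, card_union_of_disjoint, ← ih, Nat.filter_coprime_Ico_eq_totient]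
      · ring
      · exact disjoint_filter_filter (Ico_disjoint_Ico_consecutive _ _ _)
  rw [key]
  refine card_le_card (filter_subset_filter _ ?_)
  intro q hq
  rw [mem_Ico] at hq
  rw [mem_Icc]
  lia

lemma card_filter_coprime_dvd_le {P : ℕ} (hP : P ≠ 0) (Q : ℕ) {l : ℕ} (hl : 0 < l) :
    #{q ∈ Icc 1 Q | P.Coprime q ∧ l ∣ q} ≤ P.totient * (Q / l / P + 1) := by
  refine le_trans ?_ (Nat.Ico_filter_coprime_le 1 (Q / l) hP)
  refine card_le_card_of_injOn (fun q => q / l) ?_ ?_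
  · intro q hq
    rw [mem_coe, mem_filter, mem_Icc] at hq
    obtain ⟨⟨h1, h2⟩, h3, h4⟩ := hq
    rw [mem_coe, mem_filter, mem_Ico]
    refine ⟨⟨Nat.div_pos (Nat.le_of_dvd h1 h4) hl, ?_⟩, ?_⟩
    · have := Nat.div_le_div_right (c := l) h2
      lia
    · exact Nat.Coprime.coprime_dvd_right (Nat.div_dvd_of_dvd h4) h3
  · intro q hq q' hq' h
    rw [mem_coe, mem_filter] at hq hq'
    have h : q / l = q' / l := h
    rw [← Nat.div_mul_cancel hq.2.2, h, Nat.div_mul_cancel hq'.2.2]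

lemma card_coprime_ge {K Q W : ℕ} (hK : 2560 ≤ K) (hQ : 2 ^ 2 ^ (K + 2) ≤ Q) (hW : W ≠ 0)
    (hWle : W ≤ 2 ^ (640 * 2 ^ K)) :
    (Q : ℝ) / 4 * ∏ q ∈ Nat.primesLE (2 ^ K), (1 - (q : ℝ)⁻¹) ≤
      #{q ∈ Icc 1 Q | q.Coprime W} := by
  classical
  set P := primorial (2 ^ K) with hP
  have hP0 : P ≠ 0 := (primorial_pos _).ne'
  set D := {l ∈ W.primeFactors | 2 ^ K < l} with hD
  have hDcard : K * #D ≤ 640 * 2 ^ K := by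
    have h1 : (2 ^ K) ^ #D ≤ 2 ^ (640 * 2 ^ K) :=
      calc (2 ^ K) ^ #D ≤ ∏ q ∈ D, q := pow_card_le_prod _ _ _ fun q hq => (mem_filter.1 hq).2.le
        _ ≤ ∏ q ∈ W.primeFactors, q :=
            prod_le_prod_of_subset_of_one_le' (filter_subset _ _)
              fun q hq _ => (Nat.prime_of_mem_primeFactors hq).one_le
        _ ≤ W := Nat.le_of_dvd (Nat.pos_of_ne_zero hW) (Nat.prod_primeFactors_dvd W)
        _ ≤ _ := hWle
    rw [← pow_mul] at h1
    exact (Nat.pow_le_pow_iff_right (by norm_num)).1 h1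
  have hD4 : 4 * #D ≤ 2 ^ K := by nlinarith
  have hPle : P ≤ 2 ^ 2 ^ (K + 1) := by
    refine (primorial_le_four_pow _).trans (le_of_eq ?_)
    rw [show (4 : ℕ) = 2 ^ 2 by norm_num, ← pow_mul, pow_succ, mul_comm]
  have hPQ : P * 2 ^ K ≤ Q := by
    have hK2 : 2 ^ K ≤ 2 ^ 2 ^ (K + 1) := Nat.pow_le_pow_right (by norm_num)
      (Nat.lt_two_pow_self.le.trans (Nat.pow_le_pow_right (by norm_num) (by lia)))
    refine (Nat.mul_le_mul hPle hK2).trans ((le_of_eq ?_).trans hQ)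
    rw [← pow_add]
    congr 1
    ring
  have hcover : ({q ∈ Icc 1 Q | P.Coprime q} : Finset ℕ) ⊆
      {q ∈ Icc 1 Q | q.Coprime W} ∪ D.biUnion fun l => {q ∈ Icc 1 Q | P.Coprime q ∧ l ∣ q} := by
    intro q hq
    rw [mem_filter] at hq
    rw [mem_union, mem_filter, mem_biUnion]
    by_cases hqW : q.Coprime W
    · exact Or.inl ⟨hq.1, hqW⟩
    · obtain ⟨l, hl, hlq, hlW⟩ := Nat.Prime.not_coprime_iff_dvd.1 hqW
      refine Or.inr ⟨l, ?_, mem_filter.2 ⟨hq.1, hq.2, hlq⟩⟩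
      rw [hD, mem_filter, Nat.mem_primeFactors]
      refine ⟨⟨hl, hlW, hW⟩, ?_⟩
      by_contra hle
      have h1 : l ∣ P := by
        have : l ∈ P.primeFactors := by
          rw [hP, primorial_primeFactors, Nat.mem_primesLE]
          exact ⟨not_lt.1 hle, hl⟩
        exact Nat.dvd_of_mem_primeFactors this
      exact Nat.Prime.not_coprime_iff_dvd.2 ⟨l, hl, h1, hlq⟩ hq.2
  have hcount : P.totient * (Q / P) ≤
      #{q ∈ Icc 1 Q | q.Coprime W} + ∑ l ∈ D, P.totient * (Q / l / P + 1) := by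
    refine (card_filter_coprime_Icc_ge P Q).trans ((card_le_card hcover).trans
      ((card_union_le _ _).trans ?_))
    gcongr
    refine card_biUnion_le.trans (sum_le_sum fun l hl => ?_)
    exact card_filter_coprime_dvd_le hP0 Q
      (Nat.prime_of_mem_primeFactors (mem_filter.1 hl).1).pos
  have hφ : (P.totient : ℝ) = P * ∏ q ∈ Nat.primesLE (2 ^ K), (1 - (q : ℝ)⁻¹) := by
    have := Nat.totient_eq_mul_prod_factors P
    rw [hP, primorial_primeFactors, ← hP] at this
    have h := congrArg (fun x : ℚ => (x : ℝ)) this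
    push_cast at h
    exact h
  set κ := ∏ q ∈ Nat.primesLE (2 ^ K), (1 - (q : ℝ)⁻¹) with hκ
  have hκ0 : 0 ≤ κ := prod_nonneg fun q hq => (one_sub_inv_prime_pos hq).le
  have hPR : (0 : ℝ) < P := by exact_mod_cast Nat.pos_of_ne_zero hP0
  have h2K : (0 : ℝ) < 2 ^ K := by positivity
  have hcount' : (P.totient : ℝ) * (Q / P - 1) ≤
      #{q ∈ Icc 1 Q | q.Coprime W} + #D * (P.totient * (Q / 2 ^ K / P + 1)) := by
    have h1 : (P.totient : ℝ) * ((Q / P : ℕ) : ℝ) ≤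
        #{q ∈ Icc 1 Q | q.Coprime W} +
          ∑ l ∈ D, (P.totient : ℝ) * (((Q / l / P : ℕ) : ℝ) + 1) := by exact_mod_cast hcount
    have h2 : (Q : ℝ) / P - 1 ≤ ((Q / P : ℕ) : ℝ) := by
      have := Nat.lt_floor_add_one ((Q : ℝ) / P)
      rw [Nat.floor_div_eq_div] at this
      linarith
    have h3 : ∑ l ∈ D, (P.totient : ℝ) * (((Q / l / P : ℕ) : ℝ) + 1) ≤
        #D * (P.totient * (Q / 2 ^ K / P + 1)) := by
      rw [← nsmul_eq_mul]
      refine sum_le_card_nsmul _ _ _ fun l hl => ?_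
      have hl' : (2 ^ K : ℝ) ≤ l := by exact_mod_cast (mem_filter.1 hl).2.le
      gcongr
      calc ((Q / l / P : ℕ) : ℝ) ≤ ((Q / l : ℕ) : ℝ) / P := Nat.cast_div_le
        _ ≤ (Q : ℝ) / l / P := by gcongr; exact Nat.cast_div_le
        _ ≤ (Q : ℝ) / 2 ^ K / P := by gcongr
    have h4 : (P.totient : ℝ) * (Q / P - 1) ≤ (P.totient : ℝ) * ((Q / P : ℕ) : ℝ) := by gcongr
    linarith
  set u : ℝ := (Q : ℝ) / P with hu
  have hQu : (Q : ℝ) = u * P := by rw [hu]; field_simp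
  have hu2K : (2 ^ K : ℝ) ≤ u := by
    rw [hu, le_div_iff₀ hPR]
    have : ((P * 2 ^ K : ℕ) : ℝ) ≤ Q := by exact_mod_cast hPQ
    push_cast at this
    linarith
  have hD4' : 4 * (#D : ℝ) ≤ 2 ^ K := by exact_mod_cast hD4
  have h4u : (4 : ℝ) ≤ u := by
    refine le_trans ?_ hu2K
    calc (4 : ℝ) = 2 ^ 2 := by norm_num
      _ ≤ 2 ^ K := by gcongr <;> [norm_num; lia]
  have e1 : (Q : ℝ) / 2 ^ K / P = u / 2 ^ K := by rw [hu]; field_simp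
  have e2 : (#D : ℝ) * (u / 2 ^ K) ≤ u / 4 := by
    rw [← mul_div_assoc, div_le_div_iff₀ h2K (by norm_num)]
    have hu0 : 0 ≤ u := by linarith
    nlinarith
  rw [e1] at hcount'
  have hφ0 : (0 : ℝ) ≤ P.totient := by positivity
  have e3 : (#D : ℝ) * (P.totient * (u / 2 ^ K + 1)) ≤ P.totient * (u / 2) := by
    have : (#D : ℝ) * (u / 2 ^ K + 1) ≤ u / 2 := by linarith
    calc (#D : ℝ) * (P.totient * (u / 2 ^ K + 1)) = P.totient * (#D * (u / 2 ^ K + 1)) := by ring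
      _ ≤ _ := by gcongr
  have e4 : (P.totient : ℝ) * (u / 4) ≤ P.totient * (u - 1) - P.totient * (u / 2) := by
    rw [← mul_sub]; gcongr; linarith
  have e5 : (Q : ℝ) / 4 * κ = P.totient * (u / 4) := by rw [hφ, hQu]; ring
  rw [e5]
  linarith

end Coprime

section CoprimeAsymptotic

/-- Integers `W ≤ p ^ 2` are coprime to a proportion at least `(log p) ^ (-1 / 400)` of the
integers in `[1, Q]`, as soon as `p ^ (1 / 40) ≤ Q ≤ p`. -/
lemma exists_card_coprime_ge_rpow_logb : ∃ p₀ : ℕ, ∀ p : ℕ, p₀ ≤ p → ∀ Q : ℕ,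
    (p : ℝ) ^ ((1 : ℝ) / 40) ≤ Q → Q ≤ p → ∀ W : ℕ, W ≠ 0 → W ≤ p ^ 2 →
      (Q : ℝ) * Real.logb 2 p ^ (-((1 : ℝ) / 400)) ≤ #{q ∈ Icc 1 Q | q.Coprime W} := by
  obtain ⟨c, hc, hprod⟩ := exists_le_prod_one_sub_inv
  set r : ℝ := (2 : ℝ) ^ ((1 : ℝ) / 400) with hr
  have hr1 : 1 < r := Real.one_lt_rpow (by norm_num) (by norm_num)
  have hr0 : 0 < r := by linarith
  have hlim := tendsto_pow_const_div_const_pow_of_one_lt 4 hr1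
  obtain ⟨K₀, hK₀⟩ := Filter.eventually_atTop.1
    (hlim.eventually_lt_const (show (0 : ℝ) < c / 4 by positivity))
  set K₁ := max K₀ 2560 with hK₁
  refine ⟨2 ^ (40 * (2 ^ (K₁ + 3) + 1)), fun p hp Q hQ hQp W hW hWle => ?_⟩
  have hp1 : 1 ≤ p := Nat.one_le_two_pow.trans hp
  have hpR : (1 : ℝ) ≤ p := by exact_mod_cast hp1
  have hQ40 : p ≤ Q ^ 40 := by
    have h1 : ((p : ℝ) ^ ((1 : ℝ) / 40)) ^ 40 ≤ (Q : ℝ) ^ 40 := by gcongr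
    rw [← Real.rpow_natCast, ← Real.rpow_mul (by positivity)] at h1
    norm_num at h1
    exact_mod_cast h1
  have hQ0 : Q ≠ 0 := by
    rintro rfl
    simp at hQ40
    lia
  set ν := Nat.log 2 Q with hν
  have hQlt : Q < 2 ^ (ν + 1) := Nat.lt_pow_succ_log_self (by norm_num) Q
  have hQge : 2 ^ ν ≤ Q := Nat.pow_log_le_self 2 hQ0
  have hplt : p < 2 ^ (40 * (ν + 1)) := by
    refine hQ40.trans_lt ?_
    rw [mul_comm, pow_mul]
    exact Nat.pow_lt_pow_left hQlt (by norm_num)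
  have hνK : 2 ^ (K₁ + 3) < ν := by
    have := (Nat.pow_lt_pow_iff_right (by norm_num : 1 < 2)).1 (hp.trans_lt hplt)
    lia
  have hlogν : K₁ + 3 ≤ Nat.log 2 ν := Nat.le_log_of_pow_le (by norm_num) hνK.le
  obtain ⟨K, hK⟩ : ∃ K, Nat.log 2 ν = K + 2 := ⟨Nat.log 2 ν - 2, by lia⟩
  have hKK : K₁ ≤ K := by lia
  have hνge : 2 ^ (K + 2) ≤ ν := hK ▸ Nat.pow_log_le_self 2 (by lia)
  have hνlt : ν < 2 ^ (K + 3) := by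
    have := Nat.lt_pow_succ_log_self (by norm_num : 1 < 2) ν
    rwa [hK] at this
  have hple : p ≤ 2 ^ (320 * 2 ^ K) := by
    refine hplt.le.trans (Nat.pow_le_pow_right (by norm_num) ?_)
    rw [pow_add] at hνlt
    lia
  have hWle' : W ≤ 2 ^ (640 * 2 ^ K) := by
    refine hWle.trans ((Nat.pow_le_pow_left hple 2).trans (le_of_eq ?_))
    rw [← pow_mul]
    congr 1
    ring
  have hcard := card_coprime_ge (K := K) (by lia)
    ((Nat.pow_le_pow_right (by norm_num) hνge).trans hQge) hW hWle'
  refine le_trans ?_ hcard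
  rw [div_mul_eq_mul_div, mul_div_assoc]
  refine mul_le_mul_of_nonneg_left ?_ (by positivity)
  have hKpos : (0 : ℝ) < K := by exact_mod_cast (by lia : 0 < K)
  have hL : (2 : ℝ) ^ K ≤ Real.logb 2 p := by
    rw [Real.le_logb_iff_rpow_le (by norm_num) (by linarith)]
    have h1 : 2 ^ 2 ^ K ≤ p :=
      ((Nat.pow_le_pow_right (by norm_num) ((Nat.pow_le_pow_right (by norm_num)
        (by lia)).trans hνge)).trans hQge).trans hQp
    have : ((2 : ℝ) ^ ((2 ^ K : ℕ) : ℝ)) ≤ p := by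
      rw [Real.rpow_natCast]; exact_mod_cast h1
    exact_mod_cast this
  have hLr : r ^ K ≤ Real.logb 2 p ^ ((1 : ℝ) / 400) := by
    refine le_trans (le_of_eq ?_) (Real.rpow_le_rpow (by positivity) hL (by norm_num))
    rw [hr, ← Real.rpow_natCast, ← Real.rpow_natCast, ← Real.rpow_mul (by norm_num),
      ← Real.rpow_mul (by norm_num), mul_comm]
  have hKr : (K : ℝ) ^ 4 / r ^ K < c / 4 := hK₀ K ((le_max_left _ _).trans hKK)
  have hL0 : 0 ≤ Real.logb 2 p := le_trans (by positivity) hL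
  rw [Real.rpow_neg hL0]
  have hrK : 0 < r ^ K := by positivity
  calc (Real.logb 2 p ^ ((1 : ℝ) / 400))⁻¹ ≤ (r ^ K)⁻¹ := inv_anti₀ hrK hLr
    _ ≤ c / K ^ 4 / 4 := by
        rw [div_lt_iff₀ hrK] at hKr
        rw [inv_eq_one_div, div_div, div_le_div_iff₀ hrK (mul_pos (pow_pos hKpos 4) four_pos)]
        linarith
    _ ≤ _ := by
        have := hprod K (by lia)
        linarith

end CoprimeAsymptotic

section GoodPairs

lemma exists_rational_approx {p s h Q : ℕ} (hp : p.Prime) (hQ : 0 < Q)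
    (hsize : 16 * Q ^ 2 * (h + 1) ≤ p) (hs : s + h + 1 < p) :
    ∃ a b : ℤ, ∀ x : ℕ, s < x → x ≤ s + h + 1 →
      a * p - b * x ≠ 0 ∧ 2 * Q * |a * p - b * x| < p := by
  obtain ⟨j, k, hk0, hk, hjk⟩ :=
    Real.exists_int_int_abs_mul_sub_le ((s : ℝ) / p) (n := 4 * Q) (by lia)
  have hpR : (0 : ℝ) < p := by exact_mod_cast hp.pos
  have hA : (4 * Q + 1) * |j * p - k * s| ≤ p := by
    have h1 : |(k : ℝ) * (s / p) - j| * p = |(j : ℝ) * p - k * s| := by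
      rw [← abs_of_pos hpR, ← abs_mul, abs_of_pos hpR, abs_sub_comm]
      congr 1
      field_simp
    rw [le_div_iff₀ (by positivity)] at hjk
    have h2 : (4 * Q + 1) * |(j : ℝ) * p - k * s| ≤ p := by
      rw [← h1]
      push_cast at hjk
      nlinarith
    exact_mod_cast h2
  refine ⟨j, k, fun x hsx hx => ⟨fun h0 => ?_, ?_⟩⟩
  · have hdvd : (p : ℤ) ∣ k * x := ⟨j, by linarith⟩
    rcases Int.Prime.dvd_mul' hp hdvd with h | h
    · have h1 := Int.le_of_dvd hk0 h
      have h2 : (p : ℤ) ≤ 4 * Q := by lia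
      have h3 : (4 * Q) * (4 * Q) ≤ 4 * Q := by
        have : p ≤ 4 * Q := by exact_mod_cast h2
        nlinarith
      have h4 : 4 * Q ≤ 1 := Nat.le_of_mul_le_mul_left (by simpa using h3) (by lia : 0 < 4 * Q)
      lia
    · have := Nat.le_of_dvd (by lia) (Int.natCast_dvd_natCast.1 h)
      lia
  · obtain ⟨t, rfl⟩ : ∃ t, x = s + t := ⟨x - s, by lia⟩
    have ht : (t : ℤ) ≤ h + 1 := by lia
    set A := |j * p - k * s| with hAdef
    have hA0 : 0 ≤ A := abs_nonneg _
    have h1 : |j * p - k * ((s + t : ℕ) : ℤ)| ≤ A + k * t := by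
      have : j * p - k * ((s + t : ℕ) : ℤ) = (j * p - k * s) - k * t := by push_cast; ring
      rw [this]
      refine (abs_sub _ _).trans (le_of_eq ?_)
      rw [abs_of_nonneg (show (0 : ℤ) ≤ k * t by positivity)]
    have h2 : 4 * Q * A < p := by
      rcases hA0.eq_or_lt with h | h
      · rw [← h]; simpa using hp.pos
      · lia
    have h3 : k * t ≤ 4 * Q * (h + 1) := by
      have : k ≤ 4 * Q := by exact_mod_cast hk
      gcongr
    have h4 : (16 * Q ^ 2 * (h + 1) : ℤ) ≤ p := by exact_mod_cast hsize
    have h5 : 2 * (Q : ℤ) * |j * p - k * ((s + t : ℕ) : ℤ)| ≤ 2 * Q * (A + 4 * Q * (h + 1)) := by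
      gcongr
      exact h1.trans (by linarith)
    nlinarith

variable {p : ℕ} [Fact p.Prime]

lemma eq_of_div_eq_div {a b : ℤ} {Q x x' q q' : ℕ} (hx : x < p) (hx' : x' < p)
    (hq : 0 < q) (hq' : 0 < q') (hqQ : q ≤ Q) (hqQ' : q' ≤ Q) (hQp : Q < p)
    (hw : 2 * Q * |a * p - b * x| < p) (hw' : 2 * Q * |a * p - b * x'| < p)
    (hc : IsCoprime (q : ℤ) (a * p - b * x)) (hc' : IsCoprime (q' : ℤ) (a * p - b * x'))
    (heq : (x : ZMod p) / q = x' / q') : x = x' ∧ q = q' := by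
  have hne : ∀ n : ℕ, 0 < n → n < p → (n : ZMod p) ≠ 0 := fun n h0 hn h =>
    absurd (Nat.le_of_dvd h0 ((ZMod.natCast_eq_zero_iff n p).1 h)) (by lia)
  have hq0 := hne q hq (by lia)
  have hq0' := hne q' hq' (by lia)
  have hmul : (x : ZMod p) * q' = x' * q := (div_eq_div_iff hq0 hq0').1 heq
  set w := a * p - b * x with hwdef
  set w' := a * p - b * x' with hwdef'
  have hdvd : (p : ℤ) ∣ w * q' - w' * q := by
    rw [← ZMod.intCast_zmod_eq_zero_iff_dvd]
    push_cast [hwdef, hwdef']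
    simp only [CharP.cast_eq_zero, mul_zero, zero_sub]
    linear_combination (-(b : ZMod p)) * hmul
  have habs : |w * q' - w' * q| < p := by
    have h1 : |w * q'| ≤ |w| * Q := by
      rw [abs_mul, Nat.abs_cast]; gcongr
    have h2 : |w' * q| ≤ |w'| * Q := by
      rw [abs_mul, Nat.abs_cast]; gcongr
    have := abs_sub (w * q') (w' * q)
    nlinarith
  have hww : w * q' = w' * q := by
    have := Int.eq_zero_of_abs_lt_dvd hdvd habs
    linarith
  have h1 : (q : ℤ) ∣ q' := hc.dvd_of_dvd_mul_left ⟨w', by linarith⟩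
  have h2 : (q' : ℤ) ∣ q := hc'.dvd_of_dvd_mul_left ⟨w, by linarith⟩
  have hqq : q = q' := Nat.dvd_antisymm (Int.natCast_dvd_natCast.1 h1) (Int.natCast_dvd_natCast.1 h2)
  refine ⟨?_, hqq⟩
  subst hqq
  have h3 : (x : ZMod p) = x' := mul_right_cancel₀ hq0 hmul
  rw [ZMod.natCast_eq_natCast_iff', Nat.mod_eq_of_lt hx, Nat.mod_eq_of_lt hx'] at h3
  exact h3

/-- Each `x ∈ (s, s + h]` has many moduli `q ∈ g x` for which the quotients `x / q` are pairwise
distinct, as are the quotients `(x + 1) / q`, and `g` is compatible with shifts by `q`. -/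
lemma exists_moduli {s h Q : ℕ} {κ : ℝ} (hQ : 0 < Q) (hsize : 16 * Q ^ 2 * (h + 1) ≤ p)
    (hs : s + h + 1 < p)
    (hκ : ∀ W : ℕ, W ≠ 0 → W ≤ p ^ 2 → Q * κ ≤ #{q ∈ Icc 1 Q | q.Coprime W}) :
    ∃ g : ℕ → Finset ℕ, (∀ x, g x ⊆ Icc 1 Q) ∧
      (∀ x ∈ Ioc s (s + h), Q * κ ≤ #(g x)) ∧
      (∀ x ∈ Ioc s (s + h), ∀ x' ∈ Ioc s (s + h), ∀ q ∈ g x, ∀ q' ∈ g x',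
        (x : ZMod p) / q = x' / q' → x = x' ∧ q = q') ∧
      (∀ x ∈ Ioc s (s + h), ∀ x' ∈ Ioc s (s + h), ∀ q ∈ g x, ∀ q' ∈ g x',
        ((x : ZMod p) + 1) / q = (x' + 1) / q' → x = x' ∧ q = q') ∧
      ∀ x q m, q ∈ g (x + q * m) → q ∈ g x := by
  have hp : p.Prime := Fact.out
  obtain ⟨a, b, hab⟩ := exists_rational_approx hp hQ hsize hs
  have hQp : Q < p := by nlinarith
  have hcop : ∀ {x q : ℕ}, q.Coprime ((a * p - b * x) * (a * p - b * (x + 1 : ℕ)) : ℤ).natAbs ↔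
      IsCoprime (q : ℤ) (a * p - b * x) ∧ IsCoprime (q : ℤ) (a * p - b * (x + 1 : ℕ)) := by
    intro x q
    rw [← IsCoprime.mul_right_iff, Int.isCoprime_iff_gcd_eq_one, Int.gcd, Int.natAbs_natCast]
  refine ⟨fun x => {q ∈ Icc 1 Q |
    q.Coprime ((a * p - b * x) * (a * p - b * (x + 1 : ℕ)) : ℤ).natAbs},
    fun x => filter_subset _ _, fun x hx => ?_, fun x hx x' hx' q hq q' hq' heq => ?_,
    fun x hx x' hx' q hq q' hq' heq => ?_, fun x q m hq => ?_⟩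
  · rw [mem_Ioc] at hx
    obtain ⟨h1, h2⟩ := hab x hx.1 (by lia)
    obtain ⟨h3, h4⟩ := hab (x + 1) (by lia) (by lia)
    refine hκ _ (Int.natAbs_ne_zero.2 (mul_ne_zero h1 h3)) ?_
    have hle : ∀ w : ℤ, 2 * Q * |w| < p → w.natAbs ≤ p := by
      intro w hw
      have : 1 ≤ (Q : ℤ) := by exact_mod_cast hQ
      have : |w| ≤ p := by nlinarith [abs_nonneg w]
      rw [Int.abs_eq_natAbs] at this
      exact_mod_cast this
    rw [Int.natAbs_mul, pow_two]
    exact Nat.mul_le_mul (hle _ h2) (hle _ h4)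
  · rw [mem_Ioc] at hx hx'
    rw [mem_filter, mem_Icc, hcop] at hq hq'
    exact eq_of_div_eq_div (by lia) (by lia) hq.1.1 hq'.1.1 hq.1.2 hq'.1.2 hQp
      (hab x hx.1 (by lia)).2 (hab x' hx'.1 (by lia)).2 hq.2.1 hq'.2.1 heq
  · rw [mem_Ioc] at hx hx'
    rw [mem_filter, mem_Icc, hcop] at hq hq'
    have := eq_of_div_eq_div (x := x + 1) (x' := x' + 1) (by lia) (by lia) hq.1.1 hq'.1.1
      hq.1.2 hq'.1.2 hQp (hab (x + 1) (by lia) (by lia)).2 (hab (x' + 1) (by lia) (by lia)).2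
      hq.2.2 hq'.2.2 (by push_cast; exact heq)
    exact ⟨by lia, this.2⟩
  · rw [mem_filter, hcop] at hq ⊢
    refine ⟨hq.1, ?_, ?_⟩
    · have e : a * p - b * x = (a * p - b * (x + q * m : ℕ)) + q * (b * m) := by push_cast; ring
      rw [e]
      exact hq.2.1.add_mul_left_right _
    · have e : a * p - b * (x + 1 : ℕ) =
          (a * p - b * (x + q * m + 1 : ℕ)) + q * (b * m) := by push_cast; ring
      rw [e]
      exact hq.2.2.add_mul_left_right _

end GoodPairs

section ShiftedSums

variable {p : ℕ} [Fact p.Prime]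

lemma natCast_ne_zero_of_lt {n : ℕ} (h0 : 0 < n) (hn : n < p) : (n : ZMod p) ≠ 0 := fun h =>
  absurd (Nat.le_of_dvd h0 ((ZMod.natCast_eq_zero_iff n p).1 h)) (by lia)

lemma quadraticChar_div_add {q : ZMod p} (hq : q ≠ 0) (x m : ZMod p) :
    quadraticChar (ZMod p) (x / q + m) =
      quadraticChar (ZMod p) q * quadraticChar (ZMod p) (x + q * m) := by
  have h : x + q * m = q * (x / q + m) := by field_simp
  rw [h, map_mul, ← mul_assoc, ← pow_two, quadraticChar_sq_one hq, one_mul]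

lemma abs_sum_quadraticChar_div_add {q : ZMod p} (hq : q ≠ 0) (x : ZMod p) (M : ℕ) :
    |∑ m ∈ range M, quadraticChar (ZMod p) (x / q + m)| =
      |∑ m ∈ range M, quadraticChar (ZMod p) (x + q * m)| := by
  simp only [quadraticChar_div_add hq]
  rw [← mul_sum, abs_mul]
  rcases quadraticChar_dichotomy hq with h | h <;> simp [h]

lemma mul_sum_card_le {g : ℕ → Finset ℕ} {Q M s k : ℕ} {E : Finset ℕ} (hg : ∀ x, g x ⊆ Icc 1 Q)
    (hshift : ∀ x q m, q ∈ g (x + q * m) → q ∈ g x) (hQM : Q * M ≤ k)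
    (hE : E ⊆ Ioc (s + k) (s + 2 * k)) :
    M * ∑ e ∈ E, #(g e) ≤
      ∑ i ∈ (Ioc s (s + 2 * k)).sigma g, #{m ∈ range M | i.1 + i.2 * m ∈ E} := by
  rw [← card_sigma, ← card_sigma, mul_comm, ← card_range M, ← card_product, card_range]
  refine card_le_card_of_injOn
    (fun t => (⟨⟨t.1.1 - t.1.2 * t.2, t.1.2⟩, t.2⟩ : Sigma fun _ : (Sigma fun _ : ℕ => ℕ) => ℕ))
    ?_ ?_
  · rintro ⟨⟨e, q⟩, m⟩ h
    simp only [mem_coe, mem_product, mem_sigma, mem_range] at h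
    obtain ⟨⟨he, hq⟩, hm⟩ := h
    have hqQ := (mem_Icc.1 (hg e hq)).2
    have heI := mem_Ioc.1 (hE he)
    have hqm : q * m ≤ k := (Nat.mul_le_mul hqQ hm.le).trans hQM
    have hee : e - q * m + q * m = e := by lia
    simp only [mem_coe, mem_sigma, mem_Ioc, mem_filter, mem_range]
    refine ⟨⟨⟨by lia, by lia⟩, hshift _ q m (by rwa [hee])⟩, hm, by rwa [hee]⟩
  · rintro ⟨⟨e, q⟩, m⟩ h ⟨⟨e', q'⟩, m'⟩ h' heq
    simp only [mem_coe, mem_product, mem_sigma, mem_range] at h h'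
    obtain ⟨⟨he, hq⟩, hm⟩ := h
    obtain ⟨⟨he', hq'⟩, hm'⟩ := h'
    have hqQ := (mem_Icc.1 (hg e hq)).2
    have heI := mem_Ioc.1 (hE he)
    have heI' := mem_Ioc.1 (hE he')
    have hqm : q * m ≤ k := (Nat.mul_le_mul hqQ hm.le).trans hQM
    simp only [Sigma.mk.injEq, heq_eq_eq] at heq
    obtain ⟨⟨h1, rfl⟩, rfl⟩ := heq
    simp only [Prod.mk.injEq, Sigma.mk.injEq, heq_eq_eq, and_true]
    lia

lemma sum_abs_pow_four_le {ι : Type*} (P : Finset ι) (f : ι → ZMod p) (hf : Set.InjOn f P)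
    (T : ZMod p → ℤ) : (∑ i ∈ P, |T (f i)|) ^ 4 ≤ (#P : ℤ) ^ 3 * ∑ y, T y ^ 4 := by
  refine (pow_sum_le_card_mul_sum_pow (fun i _ => abs_nonneg _) 3).trans ?_
  gcongr
  have h1 : ∑ i ∈ P, |T (f i)| ^ (3 + 1) = ∑ y ∈ P.image f, T y ^ 4 := by
    rw [sum_image hf]
    exact sum_congr rfl fun i _ => Even.pow_abs (by decide) _
  rw [h1]
  exact sum_le_sum_of_subset_of_nonneg (subset_univ _) fun y _ _ => by positivity

lemma two_mul_ite_le {ε v v' : ℤ} {P : Prop} [Decidable P] (hε : ε = 1 ∨ ε = -1)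
    (hv : v = 1 ∨ v = -1) (hv' : v' = 1 ∨ v' = -1) (hno : ¬ (v = ε ∧ v' = ε))
    (hP : P → v = -ε ∧ v' = -ε) : 2 * (if P then (1 : ℤ) else 0) ≤ -ε * (v + v') := by
  rcases hε with rfl | rfl <;> split_ifs with h <;> simp only [h, forall_const] at hP <;> lia

/-- If no two consecutive elements of `(s, s + 3 k]` have character value `ε`, then few of them
have character value `-ε`. -/
lemma pow_four_card_consecutive_le {s k Q M : ℕ} {κ : ℝ} {ε : ℤ} (hε : ε = 1 ∨ ε = -1)
    (hκ0 : 0 ≤ κ) (hQ : 0 < Q) (hM : M ≤ p) (hQM : Q * M ≤ k)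
    (hsize : 16 * Q ^ 2 * (3 * k + 1) ≤ p) (hs : s + 3 * k + 1 < p)
    (hκ : ∀ W : ℕ, W ≠ 0 → W ≤ p ^ 2 → Q * κ ≤ #{q ∈ Icc 1 Q | q.Coprime W})
    (hno : ∀ x ∈ Ioc s (s + 3 * k), ¬ (quadraticChar (ZMod p) x = ε ∧
      quadraticChar (ZMod p) (x + 1) = ε)) :
    (Q * κ * M * #{x ∈ Ioc (s + k) (s + 2 * k) | quadraticChar (ZMod p) (x : ℕ) = -ε ∧
      quadraticChar (ZMod p) ((x : ℕ) + 1) = -ε}) ^ 4 ≤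
        (2 * k * Q) ^ 3 * (3 * M ^ 2 * p + M ^ 4 * (400 * √p)) := by
  obtain ⟨g, hg, hgcard, hinj, hinj', hshift⟩ := exists_moduli hQ hsize hs hκ
  set χ := quadraticChar (ZMod p) with hχ
  set E := {x ∈ Ioc (s + k) (s + 2 * k) | χ (x : ℕ) = -ε ∧ χ ((x : ℕ) + 1) = -ε} with hE
  have hEsub : E ⊆ Ioc (s + k) (s + 2 * k) := filter_subset _ _
  set T : ZMod p → ℤ := fun y => ∑ m ∈ range M, χ (y + m) with hT
  set P := (Ioc s (s + 2 * k)).sigma g with hP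
  have hQp : Q < p := by nlinarith
  have hpair : ∀ i ∈ P, 2 * (#{m ∈ range M | i.1 + i.2 * m ∈ E} : ℤ) ≤
      |T ((i.1 : ZMod p) / (i.2 : ℕ))| + |T (((i.1 : ZMod p) + 1) / (i.2 : ℕ))| := by
    rintro ⟨x, q⟩ hi
    obtain ⟨hx, hq⟩ := mem_sigma.1 hi
    dsimp only at hx hq ⊢
    have hqQ := mem_Icc.1 (hg x hq)
    rw [mem_Ioc] at hx
    have hq0 : (q : ZMod p) ≠ 0 := natCast_ne_zero_of_lt (by lia) (by lia)
    simp only [hT]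
    rw [abs_sum_quadraticChar_div_add hq0, abs_sum_quadraticChar_div_add hq0]
    refine le_trans ?_ (abs_add_le _ _)
    rw [← sum_add_distrib]
    have hterm : ∀ m ∈ range M, 2 * (if x + q * m ∈ E then (1 : ℤ) else 0) ≤
        -ε * (χ ((x : ZMod p) + q * m) + χ ((x : ZMod p) + 1 + q * m)) := by
      intro m hm
      have hqm : q * m ≤ k := (Nat.mul_le_mul hqQ.2 (mem_range.1 hm).le).trans hQM
      have e1 : (x : ZMod p) + q * m = ((x + q * m : ℕ) : ZMod p) := by push_cast; ring
      have e2 : (x : ZMod p) + 1 + q * m = ((x + q * m : ℕ) : ZMod p) + 1 := by push_cast; ring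
      rw [e1, e2]
      set z := x + q * m with hz
      have hz0 : (z : ZMod p) ≠ 0 := natCast_ne_zero_of_lt (by lia) (by lia)
      have hz1 : (z : ZMod p) + 1 ≠ 0 := by
        have := natCast_ne_zero_of_lt (p := p) (n := z + 1) (by lia) (by lia)
        push_cast at this
        exact this
      have hnoz := hno z (mem_Ioc.2 ⟨by lia, by lia⟩)
      exact two_mul_ite_le hε (quadraticChar_dichotomy hz0) (quadraticChar_dichotomy hz1) hnoz
        fun h => (mem_filter.1 h).2
    calc 2 * (#{m ∈ range M | x + q * m ∈ E} : ℤ)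
        = ∑ m ∈ range M, 2 * (if x + q * m ∈ E then (1 : ℤ) else 0) := by
          rw [← mul_sum, sum_boole]
      _ ≤ ∑ m ∈ range M, -ε * (χ ((x : ZMod p) + q * m) + χ ((x : ZMod p) + 1 + q * m)) :=
          sum_le_sum hterm
      _ = -ε * ∑ m ∈ range M, (χ ((x : ZMod p) + q * m) + χ ((x : ZMod p) + 1 + q * m)) := by
          rw [mul_sum]
      _ ≤ _ := by
          refine (le_abs_self _).trans (le_of_eq ?_)
          have hεabs : |-ε| = 1 := by rcases hε with rfl | rfl <;> rfl
          rw [abs_mul, hεabs, one_mul]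
  set D : ℕ := M * ∑ e ∈ E, #(g e) with hD
  set A := ∑ i ∈ P, |T ((i.1 : ZMod p) / (i.2 : ℕ))| with hA
  set B := ∑ i ∈ P, |T (((i.1 : ZMod p) + 1) / (i.2 : ℕ))| with hB
  set S := ∑ y, T y ^ 4 with hS
  have hDAB : 2 * (D : ℤ) ≤ A + B := by
    have h1 : (D : ℤ) ≤ ∑ i ∈ P, (#{m ∈ range M | i.1 + i.2 * m ∈ E} : ℤ) := by
      exact_mod_cast mul_sum_card_le hg hshift hQM hEsub
    rw [hA, hB, ← sum_add_distrib]
    refine le_trans ?_ (sum_le_sum hpair)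
    rw [← mul_sum]
    linarith
  have hsub : ∀ {x}, x ∈ Ioc s (s + 2 * k) → x ∈ Ioc s (s + 3 * k) := by
    intro x hx
    rw [mem_Ioc] at hx ⊢
    lia
  have hA4 : A ^ 4 ≤ (#P : ℤ) ^ 3 * S := by
    refine sum_abs_pow_four_le P (fun i : Sigma fun _ : ℕ => ℕ => (i.1 : ZMod p) / (i.2 : ZMod p)) ?_ T
    rintro ⟨x, q⟩ hi ⟨x', q'⟩ hi' heq
    obtain ⟨hx, hq⟩ := mem_sigma.1 (mem_coe.1 hi)
    obtain ⟨hx', hq'⟩ := mem_sigma.1 (mem_coe.1 hi')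
    obtain ⟨rfl, rfl⟩ := hinj x (hsub hx) x' (hsub hx') q hq q' hq' heq
    rfl
  have hB4 : B ^ 4 ≤ (#P : ℤ) ^ 3 * S := by
    refine sum_abs_pow_four_le P 
      (fun i : Sigma fun _ : ℕ => ℕ => ((i.1 : ZMod p) + 1) / (i.2 : ZMod p)) ?_ T
    rintro ⟨x, q⟩ hi ⟨x', q'⟩ hi' heq
    obtain ⟨hx, hq⟩ := mem_sigma.1 (mem_coe.1 hi)
    obtain ⟨hx', hq'⟩ := mem_sigma.1 (mem_coe.1 hi')
    obtain ⟨rfl, rfl⟩ := hinj' x (hsub hx) x' (hsub hx') q hq q' hq' heq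
    rfl
  have hPcard : #P ≤ 2 * k * Q := by
    rw [hP, card_sigma]
    refine (sum_le_card_nsmul _ _ Q fun x _ => ?_).trans (le_of_eq ?_)
    · simpa using card_le_card (hg x)
    · rw [Nat.card_Ioc, smul_eq_mul]
      congr 1
      lia
  have hDge : (Q : ℝ) * κ * M * #E ≤ D := by
    rw [hD]
    push_cast
    have : (#E : ℝ) * (Q * κ) ≤ ∑ e ∈ E, (#(g e) : ℝ) := by
      rw [← nsmul_eq_mul]
      refine card_nsmul_le_sum _ _ _ fun e he => hgcard e ?_
      have := mem_Ioc.1 (hEsub he)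
      exact mem_Ioc.2 ⟨by lia, by lia⟩
    calc (Q : ℝ) * κ * M * #E = M * (#E * (Q * κ)) := by ring
      _ ≤ _ := by gcongr
  have hS4 : ((S : ℤ) : ℝ) ≤ 3 * M ^ 2 * p + M ^ 4 * (400 * √p) := sum_pow_four_le hM
  have hS0 : (0 : ℝ) ≤ S := by
    have : 0 ≤ S := sum_nonneg fun y _ => Even.pow_nonneg (by decide) _
    exact_mod_cast this
  clear_value D A B S P E
  generalize #P = nP at hPcard hA4 hB4
  generalize #E = nE at hDge ⊢
  have hD4 : (D : ℤ) ^ 4 ≤ (nP : ℤ) ^ 3 * S := by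
    rcases le_total A B with h | h
    · refine (pow_le_pow_left₀ (by positivity) ?_ 4).trans hB4
      linarith
    · refine (pow_le_pow_left₀ (by positivity) ?_ 4).trans hA4
      linarith
  calc ((Q : ℝ) * κ * M * nE) ^ 4 ≤ (D : ℝ) ^ 4 := by gcongr
    _ ≤ (nP : ℝ) ^ 3 * S := by exact_mod_cast hD4
    _ ≤ (2 * k * Q) ^ 3 * (3 * M ^ 2 * p + M ^ 4 * (400 * √p)) := by
        gcongr
        exact_mod_cast hPcard

end ShiftedSums

section ConstantWindows

variable {p : ℕ} [Fact p.Prime]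

lemma eq_neg_of_not_both {ε v v' : ℤ} (hε : ε = 1 ∨ ε = -1) (hv : v = 1 ∨ v = -1)
    (hv' : v' = 1 ∨ v' = -1) (h : ¬ (v = ε ∧ v' = ε)) (h' : ¬ (v = -ε ∧ v' = -ε)) : v' = -v := by
  rcases hε with rfl | rfl <;> lia

lemma card_filter_no_mem_window_ge {a k w : ℕ} {E : Finset ℕ} :
    k ≤ #{x ∈ Ioc a (a + k) | x + w ≤ a + k ∧ ∀ e ∈ E, ¬ (x ≤ e ∧ e < x + w)} +
      w * (#E + 1) := by
  set G := {x ∈ Ioc a (a + k) | x + w ≤ a + k ∧ ∀ e ∈ E, ¬ (x ≤ e ∧ e < x + w)} with hG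
  have hcover : Ioc a (a + k) ⊆
      G ∪ (Ioc (a + k - w) (a + k) ∪ E.biUnion fun e => Ioc (e - w) e) := by
    intro x hx
    have hx' := mem_Ioc.1 hx
    simp only [mem_union, mem_biUnion]
    by_cases h1 : x + w ≤ a + k
    · by_cases h2 : ∀ e ∈ E, ¬ (x ≤ e ∧ e < x + w)
      · exact Or.inl (mem_filter.2 ⟨hx, h1, h2⟩)
      · push Not at h2
        obtain ⟨e, he, h3, h4⟩ := h2
        exact Or.inr (Or.inr ⟨e, he, mem_Ioc.2 ⟨by lia, h3⟩⟩)
    · exact Or.inr (Or.inl (mem_Ioc.2 ⟨by lia, hx'.2⟩))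
  have hcard := card_le_card hcover
  have h1 : #(Ioc (a + k - w) (a + k)) ≤ w := by rw [Nat.card_Ioc]; lia
  have h2 : #(E.biUnion fun e => Ioc (e - w) e) ≤ #E * w :=
    card_biUnion_le_card_mul _ _ _ fun e _ => by rw [Nat.card_Ioc]; lia
  have h3 := card_union_le G (Ioc (a + k - w) (a + k) ∪ E.biUnion fun e => Ioc (e - w) e)
  have h4 := card_union_le (Ioc (a + k - w) (a + k)) (E.biUnion fun e => Ioc (e - w) e)
  rw [Nat.card_Ioc] at hcard
  linarith [show a + k - a = k by lia, mul_comm w #E, mul_add w #E 1]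

/-- Outside the sparse set `E`, the character alternates, which produces many constant windows. -/
lemma mul_card_moduli_le {s k Q N : ℕ} {κ : ℝ} {ε : ℤ} (hε : ε = 1 ∨ ε = -1) (hp2 : p ≠ 2)
    (hκ0 : 0 ≤ κ) (hQ : 0 < Q) (hN : N ≤ p)
    (hsize : 16 * Q ^ 2 * (3 * k + 1) ≤ p) (hs : s + 3 * k + 1 < p)
    (hκ : ∀ W : ℕ, W ≠ 0 → W ≤ p ^ 2 → Q * κ ≤ #{q ∈ Icc 1 Q | q.Coprime W})
    (hno : ∀ x ∈ Ioc s (s + 3 * k), ¬ (quadraticChar (ZMod p) x = ε ∧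
      quadraticChar (ZMod p) (x + 1) = ε))
    (hQN : 4 * Q * N * (#{x ∈ Ioc (s + k) (s + 2 * k) | quadraticChar (ZMod p) (x : ℕ) = -ε ∧
      quadraticChar (ZMod p) ((x : ℕ) + 1) = -ε} + 1) ≤ k) :
    k / 2 * (Q * κ) ≤ 2 * (p / 2 ^ N + 100 * N * √p) := by
  obtain ⟨g, hg, hgcard, hinj, -, -⟩ := exists_moduli hQ hsize hs hκ
  set χ := quadraticChar (ZMod p) with hχ
  set E := {x ∈ Ioc (s + k) (s + 2 * k) | χ (x : ℕ) = -ε ∧ χ ((x : ℕ) + 1) = -ε} with hE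
  have hQp : Q < p := by nlinarith
  have h20 : (2 : ZMod p) ≠ 0 := by
    have := natCast_ne_zero_of_lt (p := p) (n := 2) (by lia)
      (lt_of_le_of_ne (Fact.out : p.Prime).two_le hp2.symm)
    exact_mod_cast this
  set G := {x ∈ Ioc (s + k) (s + k + k) |
    x + 2 * Q * N ≤ s + k + k ∧ ∀ e ∈ E, ¬ (x ≤ e ∧ e < x + 2 * Q * N)} with hG
  have hGcard : k ≤ 2 * #G := by
    have : k ≤ #G + 2 * Q * N * (#E + 1) := card_filter_no_mem_window_ge
    nlinarith
  have halt : ∀ x ∈ G, ∀ j ≤ 2 * Q * N, χ ((x : ZMod p) + (j : ℕ)) = (-1) ^ j * χ (x : ZMod p) := by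
    intro x hx j
    rw [hG, mem_filter, mem_Ioc] at hx
    obtain ⟨hx1, hx2, hx3⟩ := hx
    induction j with
    | zero => simp
    | succ j ih =>
      intro hj
      have ih := ih (by lia)
      have hz0 : ((x + j : ℕ) : ZMod p) ≠ 0 := natCast_ne_zero_of_lt (by lia) (by lia)
      have hz1 : ((x + j + 1 : ℕ) : ZMod p) ≠ 0 := natCast_ne_zero_of_lt (by lia) (by lia)
      have hn1 := hno (x + j) (mem_Ioc.2 ⟨by lia, by lia⟩)
      have hn2 : x + j ∉ E := fun h => hx3 _ h ⟨by lia, by lia⟩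
      have hn3 : ¬ (χ ((x + j : ℕ) : ZMod p) = -ε ∧ χ (((x + j : ℕ) : ZMod p) + 1) = -ε) :=
        fun h => hn2 (mem_filter.2 ⟨mem_Ioc.2 ⟨by lia, by lia⟩, h⟩)
      push_cast at hz0 hz1 hn1 hn3 ⊢
      have := eq_neg_of_not_both hε (quadraticChar_dichotomy hz0) (quadraticChar_dichotomy hz1)
        hn1 hn3
      rw [← add_assoc, this, ← hχ, ih, pow_succ]
      ring
  set S : ℤ → Finset (ZMod p) := fun δ => {y : ZMod p | ∀ m ∈ range N, χ (y + (m : ℕ)) = δ} with hS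
  have hScard : ∀ δ : ℤ, δ = 1 ∨ δ = -1 → (#(S δ) : ℝ) ≤ p / 2 ^ N + 100 * N * √p := by
    intro δ hδ
    have h := card_constant_window_le hN hδ
    have h2 : (0 : ℝ) < 2 ^ N := by positivity
    rw [div_add' _ _ _ h2.ne', le_div_iff₀ h2]
    exact h.trans (le_of_eq (by ring))
  have hmem : ∀ x ∈ G, x ∈ Ioc s (s + 3 * k) := by
    intro x hx
    have := mem_Ioc.1 (mem_filter.1 hx).1
    exact mem_Ioc.2 ⟨by lia, by lia⟩
  have hcount : #(G.sigma g) ≤ #(S 1 ∪ S (-1)) := by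
    refine card_le_card_of_injOn
      (fun i : Sigma fun _ : ℕ => ℕ => (i.1 : ZMod p) / (2 * (i.2 : ZMod p))) ?_ ?_
    · rintro ⟨x, q⟩ hi
      obtain ⟨hx, hq⟩ := mem_sigma.1 (mem_coe.1 hi)
      dsimp only at hx hq ⊢
      have hqQ := mem_Icc.1 (hg x hq)
      have hq0 : (q : ZMod p) ≠ 0 := natCast_ne_zero_of_lt (by lia) (by lia)
      have hx0 : (x : ZMod p) ≠ 0 := by
        have := mem_Ioc.1 (hmem x hx)
        exact natCast_ne_zero_of_lt (by lia) (by lia)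
      have h2q : 2 * (q : ZMod p) ≠ 0 := mul_ne_zero h20 hq0
      have hval : ∀ m ∈ range N, χ ((x : ZMod p) / (2 * q) + m) = χ (2 * q) * χ x := by
        intro m hm
        have hle : 2 * q * m ≤ 2 * Q * N :=
          Nat.mul_le_mul (by lia) (mem_range.1 hm).le
        have := halt x hx (2 * q * m) hle
        rw [mul_assoc 2 q m, pow_mul] at this
        push_cast at this
        rw [quadraticChar_div_add h2q, mul_assoc 2 (q : ZMod p) m, ← hχ, this]
        simp
      rw [mem_coe, mem_union]
      rcases quadraticChar_dichotomy (mul_ne_zero h2q hx0) with h | h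
      · left
        simp only [hS, mem_filter, mem_univ, true_and]
        intro m hm
        rw [hval m hm, ← map_mul, ← h]
      · right
        simp only [hS, mem_filter, mem_univ, true_and]
        intro m hm
        rw [hval m hm, ← map_mul, ← h]
    · rintro ⟨x, q⟩ hi ⟨x', q'⟩ hi' heq
      obtain ⟨hx, hq⟩ := mem_sigma.1 (mem_coe.1 hi)
      obtain ⟨hx', hq'⟩ := mem_sigma.1 (mem_coe.1 hi')
      dsimp only at hx hq hx' hq' heq
      have heq' : (x : ZMod p) / q = x' / q' := by
        have e : ∀ a b : ZMod p, a / b = 2 * (a / (2 * b)) := fun a b => by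
          rw [← mul_div_assoc, mul_div_mul_left _ _ h20]
        rw [e, heq, ← e]
      obtain ⟨rfl, rfl⟩ := hinj x (hmem x hx) x' (hmem x' hx') q hq q' hq' heq'
      rfl
  have hlow : (#G : ℝ) * (Q * κ) ≤ #(G.sigma g) := by
    rw [card_sigma, ← nsmul_eq_mul]
    push_cast
    exact card_nsmul_le_sum _ _ _ fun x hx => hgcard x (hmem x hx)
  have hup : (#(G.sigma g) : ℝ) ≤ #(S 1) + #(S (-1)) := by
    exact_mod_cast hcount.trans (card_union_le _ _)
  have h1 := hScard 1 (Or.inl rfl)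
  have h2 := hScard (-1) (Or.inr rfl)
  have hk : (k : ℝ) / 2 ≤ #G := by
    have : (k : ℝ) ≤ 2 * #G := by exact_mod_cast hGcard
    linarith
  have hQκ : 0 ≤ (Q : ℝ) * κ := mul_nonneg (Nat.cast_nonneg _) hκ0
  have h3 := mul_le_mul_of_nonneg_right hk hQκ
  linarith

end ConstantWindows

section Parameters

variable {p : ℕ} [Fact p.Prime]

/-- The main argument, with `u = p ^ (1 / 240)` and `v = (log p) ^ (1 / 400)`. -/
lemma exists_consecutive_of_parameters {u v : ℝ} {s k : ℕ} {ε : ℤ} (hε : ε = 1 ∨ ε = -1)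
    (hu : 2 ≤ u) (hv : 1 ≤ v) (hup : u ^ 240 = p) (hvL : v ^ 400 = Real.logb 2 p)
    (h1 : 2048 * v ^ 1620 ≤ u ^ 30) (h2 : 2304 * v ^ 131 ≤ u ^ 4) (h3 : 2000000 ≤ v ^ 8)
    (hcop : ∀ Q : ℕ, u ^ 6 ≤ Q → Q ≤ p → ∀ W : ℕ, W ≠ 0 → W ≤ p ^ 2 →
      Q * v⁻¹ ≤ #{q ∈ Icc 1 Q | q.Coprime W})
    (hk : u ^ 110 * v ^ 540 ≤ k) (hk' : k ≤ 2 * (u ^ 110 * v ^ 540)) (hs : s + 3 * k + 1 < p) :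
    ∃ x ∈ Ioc s (s + 3 * k), quadraticChar (ZMod p) x = ε ∧
      quadraticChar (ZMod p) (x + 1) = ε := by
  by_contra hcon
  push Not at hcon
  have hno : ∀ x ∈ Ioc s (s + 3 * k), ¬ (quadraticChar (ZMod p) x = ε ∧
      quadraticChar (ZMod p) (x + 1) = ε) := fun x hx h => hcon x hx h.1 h.2
  have hu0 : 0 < u := by linarith
  have hv0 : 0 < v := by linarith
  have hu1 : 1 ≤ u := by linarith
  have hpow : ∀ n : ℕ, n ≠ 0 → 2 ≤ u ^ n := fun n hn => hu.trans (le_self_pow₀ hu1 hn)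
  have hvpow : ∀ n : ℕ, 1 ≤ v ^ n := fun n => one_le_pow₀ hv
  have hsqrt : √p = u ^ 120 := by
    rw [← hup, show u ^ 240 = (u ^ 120) ^ 2 by ring, Real.sqrt_sq (by positivity)]
  have hk1 : (1 : ℝ) ≤ k := by
    refine le_trans ?_ hk
    calc (1 : ℝ) = 1 * 1 := by norm_num
      _ ≤ _ := by gcongr <;> [linarith [hpow 110 (by norm_num)]; exact hvpow _]
  have hk3 : ((3 * k + 1 : ℕ) : ℝ) ≤ 8 * (u ^ 110 * v ^ 540) := by
    push_cast; linarith
  have hQle : ∀ Q : ℕ, 16 * Q ^ 2 * (3 * k + 1) ≤ p → Q ≤ p := fun Q h => by nlinarith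
  have hsize : ∀ Q : ℕ, (Q : ℝ) ≤ 4 * (u ^ 50 * v ^ 540) → 16 * Q ^ 2 * (3 * k + 1) ≤ p := by
    intro Q hQ
    have : ((16 * Q ^ 2 * (3 * k + 1) : ℕ) : ℝ) ≤ p := by
      rw [Nat.cast_mul]
      calc ((16 * Q ^ 2 : ℕ) : ℝ) * ((3 * k + 1 : ℕ) : ℝ)
          ≤ 16 * (4 * (u ^ 50 * v ^ 540)) ^ 2 * (8 * (u ^ 110 * v ^ 540)) := by
            push_cast at hk3 ⊢
            gcongr
        _ = u ^ 210 * (2048 * v ^ 1620) := by ring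
        _ ≤ u ^ 210 * u ^ 30 := by gcongr
        _ = p := by rw [← hup]; ring
    exact_mod_cast this
  -- an upper bound for the exceptional set
  set M := ⌊u ^ 60⌋₊ with hM
  have hM1 : (M : ℝ) ≤ u ^ 60 := Nat.floor_le (by positivity)
  have hM2 : u ^ 60 / 2 ≤ M := by
    have := Nat.lt_floor_add_one (u ^ 60)
    have := hpow 60 (by norm_num)
    linarith
  have hMk : 2 * (M : ℝ) ≤ k :=
    calc 2 * (M : ℝ) ≤ u ^ 50 * u ^ 60 := by
          gcongr
          exact hpow 50 (by norm_num)
      _ = u ^ 110 * 1 := by ring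
      _ ≤ u ^ 110 * v ^ 540 := by gcongr; exact hvpow _
      _ ≤ k := hk
  have hM0 : 0 < M := by
    have : (0 : ℝ) < M := lt_of_lt_of_le (by positivity) hM2
    exact_mod_cast this
  set Q := k / M with hQ
  have hQM : Q * M ≤ k := Nat.div_mul_le_self k M
  have hQM' : (Q : ℝ) * M ≤ k := by exact_mod_cast hQM
  have hQM2 : (k : ℝ) / 2 ≤ Q * M := by
    have : (k : ℝ) < Q * M + M := by exact_mod_cast Nat.lt_div_mul_add hM0
    linarith
  have hQup : (Q : ℝ) ≤ 4 * (u ^ 50 * v ^ 540) := by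
    have h : (Q : ℝ) * (u ^ 60 / 2) ≤ 2 * (u ^ 110 * v ^ 540) :=
      (mul_le_mul_of_nonneg_left hM2 (by positivity)).trans (hQM'.trans hk')
    have h' : u ^ 60 * (Q : ℝ) ≤ u ^ 60 * (4 * (u ^ 50 * v ^ 540)) := by
      calc u ^ 60 * (Q : ℝ) = 2 * (Q * (u ^ 60 / 2)) := by ring
        _ ≤ 2 * (2 * (u ^ 110 * v ^ 540)) := by gcongr
        _ = _ := by ring
    exact le_of_mul_le_mul_left h' (by positivity)
  have hQlow : u ^ 6 ≤ Q := by
    have h : u ^ 60 * (u ^ 50 * v ^ 540) ≤ u ^ 60 * (2 * Q) := by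
      calc u ^ 60 * (u ^ 50 * v ^ 540) = u ^ 110 * v ^ 540 := by ring
        _ ≤ (k : ℝ) := hk
        _ ≤ 2 * ((Q : ℝ) * M) := by linarith
        _ ≤ 2 * (Q * u ^ 60) := by gcongr
        _ = _ := by ring
    have h' := le_of_mul_le_mul_left h (by positivity)
    have h'' : 2 * u ^ 6 ≤ u ^ 50 * v ^ 540 :=
      calc 2 * u ^ 6 ≤ u ^ 44 * u ^ 6 := by gcongr; exact hpow 44 (by norm_num)
        _ = u ^ 50 * 1 := by ring
        _ ≤ _ := by gcongr; exact hvpow _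
    linarith
  have hQ0 : 0 < Q := by
    have : (0 : ℝ) < Q := lt_of_lt_of_le (by positivity) hQlow
    exact_mod_cast this
  have hMp : M ≤ p := by
    have : (M : ℝ) ≤ p := by
      rw [← hup]
      exact hM1.trans (pow_le_pow_right₀ hu1 (by norm_num))
    exact_mod_cast this
  have hfour := pow_four_card_consecutive_le hε (inv_nonneg.2 hv0.le) hQ0 hMp hQM
    (hsize Q hQup) hs (hcop Q hQlow (hQle Q (hsize Q hQup))) hno
  have hwin : ∀ Q N : ℕ, _ := fun Q N hQ hN hsize hκ hQN =>
    mul_card_moduli_le (Q := Q) (N := N) hε (by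
      rintro rfl
      have := hpow 240 (by norm_num)
      have h4 : u ^ 240 = u ^ 2 * u ^ 238 := by ring
      have := hpow 238 (by norm_num)
      have : (4 : ℝ) ≤ u ^ 2 := by nlinarith
      push_cast at hup
      nlinarith) (inv_nonneg.2 hv0.le) hQ hN hsize hs hκ hno hQN
  clear hno hcon
  revert hfour hwin
  generalize #{x ∈ Ioc (s + k) (s + 2 * k) | quadraticChar (ZMod p) (x : ℕ) = -ε ∧
      quadraticChar (ZMod p) ((x : ℕ) + 1) = -ε} = e
  intro hfour hwin
  have he : (e : ℝ) ≤ 72 * (u ^ 100 * v ^ 271) := by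
    have hlow : (v⁻¹ * (u ^ 110 * v ^ 540 / 2) * e) ^ 4 ≤ (36 * (u ^ 210 * v ^ 810)) ^ 4 := by
      calc (v⁻¹ * (u ^ 110 * v ^ 540 / 2) * e) ^ 4 ≤ (v⁻¹ * (Q * M) * e) ^ 4 := by
            gcongr
            linarith
        _ = (Q * v⁻¹ * M * e) ^ 4 := by ring
        _ ≤ _ := hfour
        _ ≤ (2 * (2 * (u ^ 110 * v ^ 540)) * (4 * (u ^ 50 * v ^ 540))) ^ 3 *
              (3 * (u ^ 60) ^ 2 * u ^ 240 + (u ^ 60) ^ 4 * (400 * u ^ 120)) := by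
            rw [← hup, ← hsqrt, ← hup]
            gcongr
        _ = 1650688 * (u ^ 840 * v ^ 3240) := by ring
        _ ≤ 1679616 * (u ^ 840 * v ^ 3240) := by gcongr; norm_num
        _ = _ := by ring
    have h := (pow_le_pow_iff_left₀ (by positivity) (by positivity) (by norm_num)).1 hlow
    have h' : (u ^ 110 * v ^ 539 / 2) * e ≤ (u ^ 110 * v ^ 539 / 2) * (72 * (u ^ 100 * v ^ 271)) :=
      calc (u ^ 110 * v ^ 539 / 2) * e = v⁻¹ * (u ^ 110 * v ^ 540 / 2) * e := by
            field_simp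
        _ ≤ _ := h
        _ = _ := by ring
    exact le_of_mul_le_mul_left h' (by positivity)
  -- a lower bound for the number of constant windows
  set N := Nat.log 2 p + 1 with hN
  have hpN : (p : ℝ) ≤ 2 ^ N := by
    exact_mod_cast (Nat.lt_pow_succ_log_self (by norm_num : 1 < 2) p).le
  have hN1 : (1 : ℝ) ≤ N := by exact_mod_cast Nat.le_add_left 1 _
  have hNL : (N : ℝ) ≤ 2 * v ^ 400 := by
    have h : ((Nat.log 2 p : ℕ) : ℝ) ≤ Real.logb 2 p := by
      exact_mod_cast Real.natLog_le_logb p 2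
    rw [← hvL] at h
    have := hvpow 400
    rw [hN]
    push_cast
    linarith
  have hNp : N ≤ p := Nat.log_lt_self 2 (Fact.out : p.Prime).ne_zero
  have hB1 : (1 : ℝ) ≤ 72 * (u ^ 100 * v ^ 271) :=
    calc (1 : ℝ) ≤ 72 * (1 * 1) := by norm_num
      _ ≤ 72 * (u ^ 100 * v ^ 271) := by
          gcongr <;> [exact one_le_pow₀ hu1; exact hvpow _]
  set y : ℝ := k / (8 * N * (72 * (u ^ 100 * v ^ 271))) with hy
  have hyup : y ≤ 4 * (u ^ 50 * v ^ 540) := by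
    rw [hy, div_le_iff₀ (by positivity)]
    calc (k : ℝ) ≤ 2 * (u ^ 110 * v ^ 540) * 1 := by linarith
      _ ≤ 2 * (u ^ 110 * v ^ 540) * (u ^ 40 * v ^ 271) := by
          gcongr
          exact one_le_mul_of_one_le_of_one_le (one_le_pow₀ hu1) (hvpow _)
      _ = 2 * (u ^ 150 * v ^ 811) * 1 := by ring
      _ ≤ 2304 * (u ^ 150 * v ^ 811) * N := by gcongr; norm_num
      _ = _ := by ring
  have hylow : u ^ 10 / (1152 * v ^ 131) ≤ y := by
    rw [hy, div_le_div_iff₀ (by positivity) (by positivity)]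
    calc u ^ 10 * (8 * N * (72 * (u ^ 100 * v ^ 271)))
        ≤ u ^ 10 * (8 * (2 * v ^ 400) * (72 * (u ^ 100 * v ^ 271))) := by gcongr
      _ = u ^ 110 * v ^ 540 * (1152 * v ^ 131) := by ring
      _ ≤ k * (1152 * v ^ 131) := by gcongr
  have hy6 : 2 * u ^ 6 ≤ u ^ 10 / (1152 * v ^ 131) := by
    rw [le_div_iff₀ (by positivity)]
    calc 2 * u ^ 6 * (1152 * v ^ 131) = u ^ 6 * (2304 * v ^ 131) := by ring
      _ ≤ u ^ 6 * u ^ 4 := by gcongr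
      _ = u ^ 10 := by ring
  have hy0 : 0 ≤ y := by positivity
  set R := ⌊y⌋₊ with hR
  have hRy : (R : ℝ) ≤ y := Nat.floor_le hy0
  have hRlow : u ^ 10 / (2304 * v ^ 131) ≤ R := by
    have h4 := Nat.lt_floor_add_one y
    have h5 := hpow 6 (by norm_num)
    have h6 : u ^ 10 / (2304 * v ^ 131) = u ^ 10 / (1152 * v ^ 131) / 2 := by
      rw [div_div]; congr 1; ring
    rw [h6]
    linarith
  have hR6 : u ^ 6 ≤ R := by
    refine le_trans ?_ hRlow
    have h6 : u ^ 10 / (2304 * v ^ 131) = u ^ 10 / (1152 * v ^ 131) / 2 := by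
      rw [div_div]; congr 1; ring
    rw [h6]
    linarith
  have hR0 : 0 < R := by
    have : (0 : ℝ) < R := lt_of_lt_of_le (by positivity) hR6
    exact_mod_cast this
  have hRsize := hsize R (hRy.trans hyup)
  have hRN : 4 * R * N * (e + 1) ≤ k := by
    have : (4 : ℝ) * R * N * (e + 1) ≤ k :=
      calc (4 : ℝ) * R * N * (e + 1)
          ≤ 4 * y * N * (2 * (72 * (u ^ 100 * v ^ 271))) := by
            gcongr
            linarith
        _ = y * (8 * N * (72 * (u ^ 100 * v ^ 271))) := by ring
        _ = k := by rw [hy]; field_simp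
    exact_mod_cast this
  have hfinal := hwin R N hR0 hNp hRsize (hcop R hR6 (hQle R hRsize)) hRN
  have hlo : u ^ 120 * (v ^ 8 * v ^ 400) / 4608 ≤ k / 2 * (R * v⁻¹) :=
    calc u ^ 120 * (v ^ 8 * v ^ 400) / 4608
        = u ^ 110 * v ^ 540 / 2 * (u ^ 10 / (2304 * v ^ 131) * v⁻¹) := by
          field_simp
          ring
      _ ≤ _ := by gcongr
  have hhi : 2 * ((p : ℝ) / 2 ^ N + 100 * N * √p) ≤ 402 * (u ^ 120 * v ^ 400) := by
    have h4 : (p : ℝ) / 2 ^ N ≤ 1 := by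
      rw [div_le_one (by positivity)]
      exact hpN
    have h5 : 1 ≤ u ^ 120 * v ^ 400 :=
      one_le_mul_of_one_le_of_one_le (one_le_pow₀ hu1) (hvpow _)
    have h6 : 100 * N * √p ≤ 200 * (u ^ 120 * v ^ 400) := by
      rw [hsqrt]
      calc 100 * N * u ^ 120 ≤ 100 * (2 * v ^ 400) * u ^ 120 := by gcongr
        _ = _ := by ring
    linarith
  have hX : 0 < u ^ 120 * v ^ 400 := by positivity
  have h7 : 2000000 * (u ^ 120 * v ^ 400) ≤ u ^ 120 * (v ^ 8 * v ^ 400) :=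
    calc 2000000 * (u ^ 120 * v ^ 400) ≤ v ^ 8 * (u ^ 120 * v ^ 400) := by gcongr
      _ = _ := by ring
  linarith

end Parameters

section Asymptotic

lemma eventually_mul_rpow_logb_le : ∀ᶠ p : ℕ in Filter.atTop,
    2304 * Real.logb 2 p ^ ((81 : ℝ) / 20) ≤ (p : ℝ) ^ ((1 : ℝ) / 240) := by
  have hlog2 : 0 < Real.log 2 := Real.log_pos (by norm_num)
  have hc : 0 < Real.log 2 ^ ((81 : ℝ) / 20) / 2304 := by positivity
  have h := (isLittleO_log_rpow_rpow_atTop ((81 : ℝ) / 20)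
    (show (0 : ℝ) < 1 / 240 by norm_num)).bound hc
  filter_upwards [tendsto_natCast_atTop_atTop.eventually h, Filter.eventually_ge_atTop 1]
    with p hp hp1
  have hlog : 0 ≤ Real.log p := Real.log_natCast_nonneg p
  rw [Real.norm_of_nonneg (by positivity), Real.norm_of_nonneg (by positivity)] at hp
  rw [Real.logb, Real.div_rpow hlog hlog2.le]
  calc 2304 * (Real.log p ^ ((81 : ℝ) / 20) / Real.log 2 ^ ((81 : ℝ) / 20))
      ≤ 2304 * (Real.log 2 ^ ((81 : ℝ) / 20) / 2304 * (p : ℝ) ^ ((1 : ℝ) / 240) /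
          Real.log 2 ^ ((81 : ℝ) / 20)) := by gcongr
    _ = _ := by field_simp

/-- An interval of length of order `p ^ (11 / 24) * (log p) ^ (27 / 20)` contains consecutive
elements on which the quadratic character takes any prescribed common value. -/
lemma exists_consecutive_quadraticChar : ∃ p₀ : ℕ, ∀ (p : ℕ) [Fact p.Prime], p₀ ≤ p →
    ∃ k : ℕ, (k : ℝ) ≤ 2 * ((p : ℝ) ^ ((11 : ℝ) / 24) * Real.logb 2 p ^ ((27 : ℝ) / 20)) ∧
      1 ≤ k ∧ 3 * k + 1 < p ∧
      ∀ s : ℕ, s + 3 * k + 1 < p → ∀ ε : ℤ, ε = 1 ∨ ε = -1 →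
        ∃ x ∈ Ioc s (s + 3 * k), quadraticChar (ZMod p) x = ε ∧
          quadraticChar (ZMod p) (x + 1) = ε := by
  obtain ⟨p₁, hp₁⟩ := exists_card_coprime_ge_rpow_logb
  have hlogb : Filter.Tendsto (fun p : ℕ => Real.logb 2 p) Filter.atTop Filter.atTop :=
    (Real.tendsto_logb_atTop (by norm_num)).comp tendsto_natCast_atTop_atTop
  have hvlim : Filter.Tendsto (fun p : ℕ => Real.logb 2 p ^ ((1 : ℝ) / 400))
      Filter.atTop Filter.atTop := (tendsto_rpow_atTop (by norm_num)).comp hlogb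
  obtain ⟨p₂, hp₂⟩ := Filter.eventually_atTop.1 (eventually_mul_rpow_logb_le.and
    ((hvlim.eventually_ge_atTop 2000000).and (hlogb.eventually_ge_atTop 1)))
  refine ⟨max p₁ p₂, fun p _ hp => ?_⟩
  obtain ⟨huv, hv, hL⟩ := hp₂ p ((le_max_right _ _).trans hp)
  have hcop := hp₁ p ((le_max_left _ _).trans hp)
  have hL0 : 0 ≤ Real.logb 2 p := by linarith
  have hp0 : (0 : ℝ) ≤ p := Nat.cast_nonneg p
  set u := (p : ℝ) ^ ((1 : ℝ) / 240) with hu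
  set v := Real.logb 2 p ^ ((1 : ℝ) / 400) with hvdef
  have hupow : ∀ n : ℕ, u ^ n = (p : ℝ) ^ ((n : ℝ) / 240) := fun n => by
    rw [hu, ← Real.rpow_natCast, ← Real.rpow_mul hp0]
    congr 1
    ring
  have hvpow : ∀ n : ℕ, v ^ n = Real.logb 2 p ^ ((n : ℝ) / 400) := fun n => by
    rw [hvdef, ← Real.rpow_natCast, ← Real.rpow_mul hL0]
    congr 1
    ring
  have huv : 2304 * v ^ 1620 ≤ u := by
    rw [hvpow]
    norm_num at huv ⊢
    exact huv
  have hup : u ^ 240 = p := by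
    rw [hupow]
    norm_num
  have hvL : v ^ 400 = Real.logb 2 p := by
    rw [hvpow]
    norm_num
  have hH : (p : ℝ) ^ ((11 : ℝ) / 24) * Real.logb 2 p ^ ((27 : ℝ) / 20) =
      u ^ 110 * v ^ 540 := by
    rw [hupow, hvpow]
    norm_num
  have hu6 : u ^ 6 = (p : ℝ) ^ ((1 : ℝ) / 40) := by
    rw [hupow]
    norm_num
  have hvinv : v⁻¹ = Real.logb 2 p ^ (-((1 : ℝ) / 400)) := by
    rw [hvdef, Real.rpow_neg hL0]
  rw [← hu6, ← hvinv] at hcop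
  rw [hH]
  clear_value u v
  have hv1 : 1 ≤ v := by linarith
  have hu2 : 2 ≤ u := by
    have := one_le_pow₀ (n := 1620) hv1
    linarith
  have hu1 : 1 ≤ u := by linarith
  have hHone : 1 ≤ u ^ 110 * v ^ 540 :=
    one_le_mul_of_one_le_of_one_le (one_le_pow₀ hu1) (one_le_pow₀ hv1)
  have hv0 : 0 < v := by linarith
  have hk := Nat.le_ceil (u ^ 110 * v ^ 540)
  have hk' : (⌈u ^ 110 * v ^ 540⌉₊ : ℝ) ≤ 2 * (u ^ 110 * v ^ 540) := by
    have := Nat.ceil_lt_add_one (show 0 ≤ u ^ 110 * v ^ 540 by linarith)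
    linarith
  have hk1 : 1 ≤ ⌈u ^ 110 * v ^ 540⌉₊ := Nat.ceil_pos.2 (by linarith)
  generalize ⌈u ^ 110 * v ^ 540⌉₊ = k at hk hk' hk1
  refine ⟨k, hk', hk1, ?_, fun s hs ε hε => exists_consecutive_of_parameters hε hu2 hv1 hup hvL
    ?_ ?_ ?_ hcop hk hk' hs⟩
  · have : ((3 * k + 1 : ℕ) : ℝ) < p := by
      push_cast
      calc 3 * (k : ℝ) + 1 ≤ u ^ 110 * (7 * v ^ 540) := by linarith
        _ < u ^ 110 * (2304 * v ^ 1620) := by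
            gcongr <;> norm_num
            linarith
        _ ≤ u ^ 110 * u ^ 130 := by
            gcongr
            exact huv.trans (le_self_pow₀ hu1 (by norm_num))
        _ = p := by rw [← hup]; ring
    exact_mod_cast this
  · calc 2048 * v ^ 1620 ≤ 2304 * v ^ 1620 := by gcongr; norm_num
      _ ≤ u := huv
      _ ≤ u ^ 30 := le_self_pow₀ hu1 (by norm_num)
  · calc 2304 * v ^ 131 ≤ 2304 * v ^ 1620 := by
          gcongr
          norm_num
      _ ≤ u := huv
      _ ≤ u ^ 4 := le_self_pow₀ hu1 (by norm_num)
  · exact hv.trans (le_self_pow₀ hv1 (by norm_num))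

end Asymptotic

section Residues

variable {p : ℕ} [Fact p.Prime]

lemma mem_quadRes_of_quadraticChar_eq_one {x : ZMod p} (hx : quadraticChar (ZMod p) x = 1) :
    x ∈ quadRes p := by
  have hx0 : x ≠ 0 := by
    rintro rfl
    simp at hx
  obtain ⟨y, rfl⟩ := (quadraticChar_one_iff_isSquare hx0).1 hx
  exact mem_filter.2 ⟨mem_univ _, y, left_ne_zero_of_mul hx0, pow_two y⟩

lemma mem_nonRes_of_quadraticChar_eq_neg_one {x : ZMod p}
    (hx : quadraticChar (ZMod p) x = -1) : x ∈ nonRes p := by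
  refine mem_filter.2 ⟨mem_univ _, ?_, fun h => ?_⟩
  · rintro rfl
    simp at hx
  · obtain ⟨-, y, hy, rfl⟩ := mem_filter.1 h
    rw [quadraticChar_sq_one' hy] at hx
    norm_num at hx

/-- A statement on short intervals of integers in `(0, p)` gives one on all intervals of
residues, at the cost of a constant factor in the length. -/
lemma exists_consecutive_zmod {k h : ℕ} {ε : ℤ} (hk : 1 ≤ k) (hkp : 3 * k + 1 < p) (hkh : 7 * k ≤ h)
    (hex : ∀ s : ℕ, s + 3 * k + 1 < p → ∃ x ∈ Ioc s (s + 3 * k),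
      quadraticChar (ZMod p) x = ε ∧ quadraticChar (ZMod p) (x + 1) = ε) (s : ZMod p) :
    ∃ j ∈ Icc 1 h, quadraticChar (ZMod p) (s + (j : ℕ)) = ε ∧
      quadraticChar (ZMod p) (s + (j : ℕ) + 1) = ε := by
  have hs : ((s.val : ℕ) : ZMod p) = s := ZMod.natCast_zmod_val s
  have hlt := ZMod.val_lt s
  by_cases hcase : s.val + 3 * k + 1 < p
  · obtain ⟨x, hx, hx1, hx2⟩ := hex s.val hcase
    rw [mem_Ioc] at hx
    have e : s + ((x - s.val : ℕ) : ZMod p) = x := by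
      rw [Nat.cast_sub hx.1.le, hs]
      ring
    exact ⟨x - s.val, mem_Icc.2 ⟨by lia, by lia⟩, by rwa [e], by rwa [e]⟩
  · obtain ⟨x, hx, hx1, hx2⟩ := hex 0 (by lia)
    rw [mem_Ioc] at hx
    have e : s + ((p - s.val + x : ℕ) : ZMod p) = x := by
      rw [Nat.cast_add, Nat.cast_sub hlt.le, hs]
      simp
    exact ⟨p - s.val + x, mem_Icc.2 ⟨by lia, by lia⟩, by rwa [e], by rwa [e]⟩

end Residues

theorem stmt18 :
    ∃ c : ℝ, 0 < c ∧ ∃ p₀ : ℕ,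
      ∀ (p : ℕ) [Fact p.Prime], p₀ ≤ p →
        ∀ h : ℕ, 0 < h →
          (h : ℝ) ≥ c * (p : ℝ) ^ ((11 : ℝ) / 24) *
              (Real.logb 2 p) ^ ((4 : ℝ) / 3 + 0.16656 / 6) *
              (Real.logb 2 (Real.logb 2 p)) ^ ((1 : ℝ) / 2) →
          ∀ s : ZMod p,
            (∃ j ∈ Finset.Icc 1 h,
                s + (j : ZMod p) ∈ quadRes p ∧ s + (j : ZMod p) + 1 ∈ quadRes p) ∧
            (∃ j ∈ Finset.Icc 1 h,
                s + (j : ZMod p) ∈ nonRes p ∧ s + (j : ZMod p) + 1 ∈ nonRes p) := by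
  obtain ⟨p₁, hp₁⟩ := exists_consecutive_quadraticChar
  refine ⟨14, by norm_num, max p₁ 4, fun p _ hp h _ hh s => ?_⟩
  obtain ⟨k, hk, hk1, hkp, hex⟩ := hp₁ p ((le_max_left _ _).trans hp)
  have hp4 : (4 : ℝ) ≤ p := by exact_mod_cast (le_max_right _ _).trans hp
  have hL : 2 ≤ Real.logb 2 p := by
    rw [Real.le_logb_iff_rpow_le (by norm_num) (by linarith)]
    norm_num
    exact_mod_cast hp4
  have hLL : 1 ≤ Real.logb 2 (Real.logb 2 p) := by
    rw [Real.le_logb_iff_rpow_le (by norm_num) (by linarith)]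
    norm_num
    exact hL
  have hkh : 7 * k ≤ h := by
    have : (7 : ℝ) * k ≤ h :=
      calc (7 : ℝ) * k
          ≤ 14 * (p : ℝ) ^ ((11 : ℝ) / 24) * Real.logb 2 p ^ ((27 : ℝ) / 20) * 1 := by linarith
        _ ≤ 14 * (p : ℝ) ^ ((11 : ℝ) / 24) * (Real.logb 2 p) ^ ((4 : ℝ) / 3 + 0.16656 / 6) *
              (Real.logb 2 (Real.logb 2 p)) ^ ((1 : ℝ) / 2) := by
            gcongr
            · linarith
            · norm_num
            · exact Real.one_le_rpow hLL (by norm_num)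
        _ ≤ h := hh
    exact_mod_cast this
  constructor
  · obtain ⟨j, hj, h1, h2⟩ := exists_consecutive_zmod hk1 hkp hkh
      (fun t ht => hex t ht 1 (Or.inl rfl)) s
    exact ⟨j, hj, mem_quadRes_of_quadraticChar_eq_one h1, mem_quadRes_of_quadraticChar_eq_one h2⟩
  · obtain ⟨j, hj, h1, h2⟩ := exists_consecutive_zmod hk1 hkp hkh
      (fun t ht => hex t ht (-1) (Or.inr rfl)) s
    exact ⟨j, hj, mem_nonRes_of_quadraticChar_eq_neg_one h1,
      mem_nonRes_of_quadraticChar_eq_neg_one h2⟩
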